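/- Let G = {g_i}_{i∈Λ} and F = {f_j}_{j∈Λ̃} be two finite holomorphic IFS with the strong separation condition, defined on domains Ω_G and Ω_F respectively, sharing the same attractor A. Let ρ > 0 be such that B(a, ρ) ⊂ Ω_G ∩ Ω_F for all a ∈ A and every finite composition g_w, w ∈ Λ*, and every finite composition f_v, v ∈ Λ̃*, is a symmetry of A on every ball B(a, ρ), a ∈ A. Let s_F = inf{ |f_j'(y)| : j ∈ Λ̃, y ∈ A } and let N ∈ ℕ be such that for every n ≥ N and every w ∈ Λⁿ, sup{ |g_w'(x)| : x ∈ A } ≤ s_F. Let r = (3 − √8)ρ. Then there exists a function v : A × ⋃_{n≥N} Λⁿ → Λ̃* such that: (i) |v(a, w)| → ∞ as |w| → ∞, uniformly in a ∈ A and w; (ii) for every a ∈ A and every w ∈ Λⁿ with n ≥ N, the map H_{w, v(a,w)} := f_{v(a,w)}^{-1} ∘ g_w is defined and univalent on B(a, r) and satisfies B(H_{w, v(a,w)}(a), (s_F/25)ρ) ⊂ H_{w, v(a,w)}(B(a, r)) ⊂ B(H_{w, v(a,w)}(a), ρ); (iii) each H_{w, v(a,w)} is a symmetry of A on B(a, r);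 and (iv) there exists K = K(F, G) < ∞ such that, for every a ∈ A, the number of different functions H_{w, v(a,w)} on B(a, r), over all w ∈ Λ* with |w| ≥ N, is at most K. -/

import Mathlib

open Set Metric

noncomputable section

/-- A finite holomorphic IFS: a bounded domain `Ω ⊂ ℂ` together with finitely many
univalent maps `g i : Ω → Ω` with `closure (g i '' Ω) ⊆ Ω`. -/
structure HolIFS where
  /-- the number of maps -/
  m : ℕ
  hm : 1 ≤ m
  /-- the domain -/
  Ω : Set ℂ
  hopen : IsOpen Ω
  hconn : IsConnected Ω
  hbdd : Bornology.IsBounded Ω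
  /-- the maps of the IFS -/
  g : Fin m → ℂ → ℂ
  hdiff : ∀ i, DifferentiableOn ℂ (g i) Ω
  hinj : ∀ i, Set.InjOn (g i) Ω
  hcl : ∀ i, closure (g i '' Ω) ⊆ Ω

/-- `A` is the attractor of the IFS `S`: the (unique) nonempty compact subset of `Ω`
with `A = ⋃ i, g i '' A`. -/
def HolIFS.IsAttractor (S : HolIFS) (A : Set ℂ) : Prop :=
  A.Nonempty ∧ IsCompact A ∧ A ⊆ S.Ω ∧ A = ⋃ i, S.g i '' A

/-- The strong separation condition for the IFS `S` with attractor `A`. -/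
def HolIFS.SSC (S : HolIFS) (A : Set ℂ) : Prop :=
  ∀ i j : Fin S.m, i ≠ j → Disjoint (S.g i '' A) (S.g j '' A)

/-- For a finite word `w = [i₁, …, i_k]`, the composition `g_w = g i₁ ∘ ⋯ ∘ g i_k`. -/
def HolIFS.word (S : HolIFS) (w : List (Fin S.m)) : ℂ → ℂ :=
  w.foldr (fun i f => S.g i ∘ f) id

/-- `H` is a local holomorphic symmetry of the compact set `K` on the domain `D`. -/
def IsSymmetryOn (K D : Set ℂ) (H : ℂ → ℂ) : Prop :=
  DifferentiableOn ℂ H D ∧ ∀ x ∈ D, (x ∈ K ↔ H x ∈ K)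

open Filter Topology in
/-- An injective holomorphic function has nonvanishing derivative. -/
theorem deriv_ne_zero_of_injOn {f : ℂ → ℂ} {U : Set ℂ} (hU : IsOpen U)
    (hf : DifferentiableOn ℂ f U) (hinj : InjOn f U) {a : ℂ} (ha : a ∈ U) : deriv f a ≠ 0 := by
  intro h0
  have hUa : U ∈ 𝓝 a := hU.mem_nhds ha
  have hfa : AnalyticAt ℂ f a := hf.analyticAt hUa
  have hF : AnalyticAt ℂ (fun z => f z - f a) a := hfa.sub analyticAt_const
  have hne : ¬ ∀ᶠ z in 𝓝 a, f z - f a = 0 := by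
    intro h
    have h1 : ∀ᶠ z in 𝓝[≠] a, f z - f a = 0 ∧ z ∈ U :=
      (h.and hUa).filter_mono nhdsWithin_le_nhds
    obtain ⟨z, ⟨hz, hzU⟩, hza⟩ := (h1.and self_mem_nhdsWithin).exists
    exact hza (hinj hzU ha (sub_eq_zero.mp hz))
  obtain ⟨n, g, hg, hga, hfg⟩ := hF.exists_eventuallyEq_pow_smul_nonzero_iff.mpr hne
  have hn0 : n ≠ 0 := by
    rintro rfl
    have := hfg.self_of_nhds
    simp at this
    exact hga this.symm
  have hn1 : n ≠ 1 := by
    rintro rfl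
    have h1 : HasDerivAt (fun z => (z - a) ^ 1 • g z) (g a) a := by
      simpa using ((hasDerivAt_id a).sub_const a).fun_mul hg.differentiableAt.hasDerivAt
    have h2 : HasDerivAt (fun z => f z - f a) (g a) a := h1.congr_of_eventuallyEq hfg
    have h3 := (hfa.differentiableAt.hasDerivAt.sub_const (f a)).unique h2
    exact hga (h3 ▸ h0)
  have hn : 2 ≤ n := by omega
  have hgdiv : AnalyticAt ℂ (fun z => g z / g a) a := hg.div_const
  have hroot : AnalyticAt ℂ (fun z => (g z / g a) ^ ((n : ℂ)⁻¹)) a :=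
    hgdiv.cpow analyticAt_const (by simp [hga])
  set c : ℂ := (g a) ^ ((n : ℂ)⁻¹) with hc
  have hcn : c ^ n = g a := Complex.cpow_nat_inv_pow _ hn0
  have hc0 : c ≠ 0 := by
    intro h
    rw [h, zero_pow hn0] at hcn
    exact hga hcn.symm
  set ψ : ℂ → ℂ := fun z => (z - a) * (c * (g z / g a) ^ ((n : ℂ)⁻¹)) with hψ
  have hψa : AnalyticAt ℂ ψ a :=
    (analyticAt_id.sub analyticAt_const).mul (analyticAt_const.mul hroot)
  have hψd : HasDerivAt ψ c a := by
    simpa [hga, hψ] using ((hasDerivAt_id a).sub_const a).fun_mul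
      (hroot.differentiableAt.hasDerivAt.const_mul c)
  have hψn : ∀ z, ψ z ^ n = (z - a) ^ n * g z := by
    intro z
    simp only [hψ, mul_pow, hcn, Complex.cpow_nat_inv_pow _ hn0]
    field_simp
  have hmap : Filter.map ψ (𝓝 a) = 𝓝 0 := by
    have h1 := hψa.hasStrictDerivAt
    rw [hψd.deriv] at h1
    rw [h1.map_nhds_eq hc0]
    simp [hψ]
  have hV : ψ '' (U ∩ {z | f z - f a = (z - a) ^ n • g z}) ∈ 𝓝 (0 : ℂ) := by
    rw [← hmap]
    exact image_mem_map (inter_mem hUa hfg)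
  obtain ⟨ε, hε, hball⟩ := Metric.mem_nhds_iff.mp hV
  set w : ℂ := ((ε / 2 : ℝ) : ℂ) with hw
  have hw0 : w ≠ 0 := by
    rw [hw]; exact_mod_cast (half_pos hε).ne'
  have hwn : ‖w‖ < ε := by
    rw [hw, Complex.norm_real, Real.norm_of_nonneg (half_pos hε).le]; linarith
  have hζ := Complex.isPrimitiveRoot_exp n hn0
  set ζ := Complex.exp (2 * Real.pi * Complex.I / n) with hζdef
  have hζn : ‖ζ‖ = 1 := hζ.norm'_eq_one hn0
  obtain ⟨z₁, ⟨hz₁, hz₁'⟩, h₁⟩ := hball (show w ∈ ball 0 ε by simpa using hwn)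
  obtain ⟨z₂, ⟨hz₂, hz₂'⟩, h₂⟩ := hball (show ζ * w ∈ ball 0 ε by simpa [hζn] using hwn)
  have hzz : z₁ = z₂ := by
    apply hinj hz₁ hz₂
    have e1 : f z₁ - f a = w ^ n := by
      rw [show f z₁ - f a = _ from hz₁', smul_eq_mul, ← hψn, h₁]
    have e2 : f z₂ - f a = w ^ n := by
      rw [show f z₂ - f a = _ from hz₂', smul_eq_mul, ← hψn, h₂, mul_pow, hζ.pow_eq_one, one_mul]
    exact sub_left_injective (e1.trans e2.symm)
  rw [hzz, h₂] at h₁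
  exact hζ.ne_one (by omega) (mul_right_cancel₀ hw0 (h₁.trans (one_mul w).symm))

section AreaTheorem
open MeasureTheory Real

/-- The real-linear map `w ↦ a w + c w̄` of the complex plane. -/
def mulAddMulConj (a c : ℂ) : ℂ →L[ℝ] ℂ :=
  a • (ContinuousLinearMap.id ℝ ℂ) + c • (Complex.conjCLE : ℂ →L[ℝ] ℂ)

theorem mulAddMulConj_apply (a c w : ℂ) :
    mulAddMulConj a c w = a * w + c * (starRingEnd ℂ) w := by
  simp [mulAddMulConj]

theorem det_mulAddMulConj (a c : ℂ) :
    LinearMap.det (mulAddMulConj a c : ℂ →ₗ[ℝ] ℂ) = ‖a‖ ^ 2 - ‖c‖ ^ 2 := by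
  rw [← LinearMap.det_toMatrix Complex.basisOneI, Matrix.det_fin_two]
  simp [LinearMap.toMatrix_apply, mulAddMulConj_apply, ← Complex.normSq_eq_norm_sq,
    Complex.normSq_apply]
  ring

/-- The area of the ellipse `‖w - c w̄‖ ≤ R`. -/
theorem volume_ellipse {c : ℂ} (hc : ‖c‖ < 1) {R : ℝ} (hR : 0 ≤ R) (b : ℂ) :
    volume {w : ℂ | ‖(w - b) - c * (starRingEnd ℂ) (w - b)‖ ≤ R} =
      ENNReal.ofReal (π * R ^ 2 / (1 - ‖c‖ ^ 2)) := by
  have hdet : LinearMap.det (mulAddMulConj 1 (-c) : ℂ →ₗ[ℝ] ℂ) = 1 - ‖c‖ ^ 2 := by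
    simp [det_mulAddMulConj]
  have hpos : 0 < 1 - ‖c‖ ^ 2 := by nlinarith [norm_nonneg c]
  have hset : {w : ℂ | ‖(w - b) - c * (starRingEnd ℂ) (w - b)‖ ≤ R} =
      (fun w => w + -b) ⁻¹' ((mulAddMulConj 1 (-c) : ℂ →ₗ[ℝ] ℂ) ⁻¹' closedBall 0 R) := by
    ext w
    simp [mulAddMulConj_apply, sub_eq_add_neg]
  rw [hset, measure_preimage_add_right,
    Measure.addHaar_preimage_linearMap _ (by rw [hdet]; exact hpos.ne'), hdet,
    Complex.volume_closedBall, abs_of_pos (inv_pos.mpr hpos), ← ENNReal.ofReal_pow hR,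
    ← ENNReal.ofReal_coe_nnreal, NNReal.coe_real_pi, ← ENNReal.ofReal_mul (by positivity),
    ← ENNReal.ofReal_mul (by positivity)]
  congr 1
  field_simp

/-- The area of the image of an injective holomorphic map. -/
theorem volume_image_eq_lintegral_norm_deriv {h h' : ℂ → ℂ} {S : Set ℂ} (hS : MeasurableSet S)
    (hh : ∀ z ∈ S, HasDerivAt h (h' z) z) (hinj : InjOn h S) :
    volume (h '' S) = ∫⁻ z in S, ENNReal.ofReal (‖h' z‖ ^ 2) := by
  rw [← lintegral_abs_det_fderiv_eq_addHaar_image volume (f' := fun z => mulAddMulConj (h' z) 0) hS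
    (fun z hz => ?_) hinj]
  · simp only [ContinuousLinearMap.det, det_mulAddMulConj]
    simp
  · have h1 : mulAddMulConj (h' z) 0 = h' z • (1 : ℂ →L[ℝ] ℂ) := by
      ext; simp [mulAddMulConj_apply]
    rw [h1]
    exact (hh z hz).complexToReal_fderiv.hasFDerivWithinAt

/-- Integration over an annulus in polar coordinates. -/
theorem integral_annulus {G : ℂ → ℝ} {ε r : ℝ} (hε : 0 < ε) (hεr : ε ≤ r)
    (hG : ContinuousOn G {z | ε ≤ ‖z‖ ∧ ‖z‖ ≤ r}) :
    ∫ z in {z : ℂ | ε ≤ ‖z‖ ∧ ‖z‖ ≤ r}, G z =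
      ∫ s in ε..r, 2 * π * s * circleAverage G 0 s := by
  set S : Set ℂ := {z | ε ≤ ‖z‖ ∧ ‖z‖ ≤ r} with hS
  have hSm : MeasurableSet S :=
    (measurableSet_le measurable_const measurable_norm).inter
      (measurableSet_le measurable_norm measurable_const)
  have hcm : ∀ p : ℝ × ℝ, Complex.polarCoord.symm p = circleMap 0 p.1 p.2 := by
    intro p
    simp [circleMap, Complex.exp_mul_I]
  rw [← integral_indicator hSm, ← Complex.integral_comp_polarCoord_symm,
    polarCoord_target]
  have h1 : ∀ p ∈ Ioi (0 : ℝ) ×ˢ Ioo (-π) π,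
      p.1 • S.indicator G (Complex.polarCoord.symm p) =
        (Icc ε r ×ˢ Ioo (-π) π).indicator (fun p => p.1 * G (circleMap 0 p.1 p.2)) p := by
    rintro ⟨s, θ⟩ ⟨hs, hθ⟩
    rw [hcm]
    have hs' : |s| = s := abs_of_pos hs
    by_cases h : s ∈ Icc ε r
    · have hm : circleMap 0 s θ ∈ S := by
        simp [hS, hs', h.1, h.2]
      rw [indicator_of_mem hm, indicator_of_mem (mk_mem_prod h hθ), smul_eq_mul]
    · have hm : circleMap 0 s θ ∉ S := by
        simp only [hS, mem_ofPred_eq, norm_circleMap_zero, hs']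
        exact h
      rw [indicator_of_notMem hm, indicator_of_notMem (fun hh => h hh.1), smul_zero]
  have hsub : Icc ε r ×ˢ Ioo (-π) π ⊆ Ioi (0 : ℝ) ×ˢ Ioo (-π) π :=
    prod_mono (fun s hs => hε.trans_le hs.1) Subset.rfl
  rw [setIntegral_congr_fun (measurableSet_Ioi.prod measurableSet_Ioo) h1,
    setIntegral_indicator (measurableSet_Icc.prod measurableSet_Ioo), inter_eq_right.mpr hsub,
    Measure.volume_eq_prod, setIntegral_prod]
  · rw [intervalIntegral.integral_of_le hεr, ← integral_Icc_eq_integral_Ioc]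
    refine setIntegral_congr_fun measurableSet_Icc fun s _ => ?_
    simp only
    rw [integral_const_mul, ← integral_Ioc_eq_integral_Ioo,
      ← intervalIntegral.integral_of_le (by linarith [pi_pos]),
      circleAverage_eq_integral_add (-π),
      intervalIntegral.integral_comp_add_right (fun θ => G (circleMap 0 s θ)), smul_eq_mul]
    have e1 : (0 : ℝ) + -π = -π := by ring
    have e2 : 2 * π + -π = π := by ring
    rw [e1, e2]
    field_simp
  · refine IntegrableOn.mono_set (t := Icc ε r ×ˢ Icc (-π) π) ?_
      (prod_mono Subset.rfl Ioo_subset_Icc_self)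
    refine ContinuousOn.integrableOn_compact (isCompact_Icc.prod isCompact_Icc) ?_
    refine continuousOn_fst.mul (hG.comp (Continuous.continuousOn ?_) ?_)
    · simp only [circleMap]; fun_prop
    · rintro ⟨s, θ⟩ ⟨hs, -⟩
      have hs' : |s| = s := abs_of_pos (hε.trans_le hs.1)
      simp [hS, hs', hs.1, hs.2]

theorem le_circleAverage_norm_sq {q : ℂ → ℂ} (hq : DifferentiableOn ℂ q (ball 0 1)) {s : ℝ}
    (hs : 0 < s) (hs1 : s < 1) :
    (s ^ 4)⁻¹ + ‖q 0‖ ^ 2 ≤ circleAverage (fun z => ‖-(z ^ 2)⁻¹ + q z‖ ^ 2) 0 s := by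
  have hcb : closedBall (0 : ℂ) s ⊆ ball 0 1 := closedBall_subset_ball hs1
  have hsph : sphere (0 : ℂ) |s| ⊆ ball 0 1 := by
    rw [abs_of_pos hs]; exact sphere_subset_closedBall.trans hcb
  have hs4 : (s : ℂ) ^ 4 ≠ 0 := by exact_mod_cast (pow_pos hs 4).ne'
  set Γ : ℂ → ℂ := fun z => ((s : ℂ) ^ 4)⁻¹ - (‖q 0‖ : ℂ) ^ 2 - 2 * ((s : ℂ) ^ 4)⁻¹ * (z ^ 2 * q z)
    + 2 * ((starRingEnd ℂ) (q 0) * q z) with hΓ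
  have hΓd : DifferentiableOn ℂ Γ (ball 0 1) := by
    have h2 : DifferentiableOn ℂ (fun z : ℂ => z ^ 2) (ball 0 1) := by fun_prop
    exact ((differentiableOn_const _).sub ((h2.mul hq).const_mul _)).add
      ((hq.const_mul _).const_mul _)
  have hΓc : CircleIntegrable Γ 0 s :=
    (hΓd.continuousOn.mono (sphere_subset_closedBall.trans hcb)).circleIntegrable hs.le
  have havg : circleAverage (Complex.reCLM ∘ Γ) 0 s = (s ^ 4)⁻¹ + ‖q 0‖ ^ 2 := by
    rw [Complex.reCLM.circleAverage_comp_comm hΓc, DiffContOnCl.circleAverage]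
    · have : Γ 0 = (((s ^ 4)⁻¹ + ‖q 0‖ ^ 2 : ℝ) : ℂ) := by
        simp only [hΓ]
        rw [mul_comm ((starRingEnd ℂ) (q 0)), Complex.mul_conj, Complex.normSq_eq_norm_sq]
        push_cast
        ring
      rw [this, Complex.reCLM_apply, Complex.ofReal_re]
    · rw [abs_of_pos hs]
      exact (hΓd.mono hcb).diffContOnCl_ball Subset.rfl
  rw [← havg]
  have hcont : ContinuousOn (fun z : ℂ => ‖-(z ^ 2)⁻¹ + q z‖ ^ 2) (sphere 0 s) := by
    have hqc : ContinuousOn q (sphere 0 s) :=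
      hq.continuousOn.mono (sphere_subset_closedBall.trans hcb)
    have hi : ContinuousOn (fun z : ℂ => (z ^ 2)⁻¹) (sphere 0 s) :=
      (by fun_prop : ContinuousOn (fun z : ℂ => z ^ 2) (sphere 0 s)).inv₀ fun z hz => by
        have : z ≠ 0 := ne_of_mem_sphere hz hs.ne'
        exact pow_ne_zero 2 this
    exact ((hi.neg.add hqc).norm).pow 2
  refine circleAverage_mono ?_ (hcont.circleIntegrable hs.le) fun z hz => ?_
  · exact ((Complex.reCLM.continuous.comp_continuousOn
      (hΓd.continuousOn.mono (sphere_subset_closedBall.trans hcb)))).circleIntegrable hs.le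
  · rw [abs_of_pos hs, mem_sphere_zero_iff_norm] at hz
    have hz0 : z ≠ 0 := by rw [← norm_pos_iff, hz]; exact hs
    have hconj : (starRingEnd ℂ) ((z ^ 2)⁻¹) = ((s : ℂ) ^ 4)⁻¹ * z ^ 2 := by
      have h1 : (starRingEnd ℂ) z * z = (s : ℂ) ^ 2 := by
        rw [mul_comm, Complex.mul_conj, Complex.normSq_eq_norm_sq, hz]; push_cast; ring
      have h2 : (starRingEnd ℂ) z ≠ 0 := by simpa using hz0
      rw [map_inv₀, map_pow, show (s : ℂ) ^ 4 = ((s : ℂ) ^ 2) ^ 2 by ring, ← h1]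
      field_simp
    set u := (z ^ 2)⁻¹ with hu
    have hun : ‖u‖ ^ 2 = (s ^ 4)⁻¹ := by
      rw [hu, norm_inv, norm_pow, hz, inv_pow]; ring
    have e1 : ‖-u + q z‖ ^ 2 = ‖u‖ ^ 2 + ‖q z‖ ^ 2 - 2 * ((starRingEnd ℂ) u * q z).re := by
      simp only [← Complex.normSq_eq_norm_sq, Complex.normSq_apply, Complex.add_re, Complex.neg_re,
        Complex.add_im, Complex.neg_im, Complex.mul_re, Complex.conj_re, Complex.conj_im]
      ring
    have e2 : 0 ≤ ‖q z‖ ^ 2 + ‖q 0‖ ^ 2 - 2 * ((starRingEnd ℂ) (q 0) * q z).re := by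
      have : ‖-q 0 + q z‖ ^ 2 = ‖q z‖ ^ 2 + ‖q 0‖ ^ 2 - 2 * ((starRingEnd ℂ) (q 0) * q z).re := by
        simp only [← Complex.normSq_eq_norm_sq, Complex.normSq_apply, Complex.add_re,
          Complex.neg_re, Complex.add_im, Complex.neg_im, Complex.mul_re, Complex.conj_re,
          Complex.conj_im]
        ring
      rw [← this]; positivity
    have e3 : (Γ z).re = (s ^ 4)⁻¹ - ‖q 0‖ ^ 2 - 2 * ((starRingEnd ℂ) u * q z).re +
        2 * ((starRingEnd ℂ) (q 0) * q z).re := by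
      rw [hconj]
      have : Γ z = (((s ^ 4)⁻¹ - ‖q 0‖ ^ 2 : ℝ) : ℂ) -
          ((2 : ℝ) : ℂ) * (((s : ℂ) ^ 4)⁻¹ * z ^ 2 * q z) +
          ((2 : ℝ) : ℂ) * ((starRingEnd ℂ) (q 0) * q z) := by
        simp only [hΓ]; push_cast; ring
      rw [this, Complex.add_re, Complex.sub_re, Complex.re_ofReal_mul, Complex.re_ofReal_mul,
        Complex.ofReal_re]
    change (Γ z).re ≤ ‖-u + q z‖ ^ 2
    rw [e1, e3, hun]
    linarith

theorem norm_sub_le_of_differentiableOn_ball {k : ℂ → ℂ} (hk : DifferentiableOn ℂ k (ball 0 1))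
    {r : ℝ} (hr1 : r < 1) : ∃ C : ℝ, 0 ≤ C ∧ ∀ z : ℂ, ‖z‖ ≤ r →
      ‖k z - k 0‖ ≤ C * ‖z‖ ∧ ‖k z - k 0 - deriv k 0 * z‖ ≤ C * ‖z‖ ^ 2 := by
  have h0 : ball (0 : ℂ) 1 ∈ nhds 0 := ball_mem_nhds 0 one_pos
  have hsub : closedBall (0 : ℂ) r ⊆ ball 0 1 := closedBall_subset_ball hr1
  have hk1 : DifferentiableOn ℂ (dslope k 0) (ball 0 1) :=
    (Complex.differentiableOn_dslope h0).mpr hk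
  have hk2 : DifferentiableOn ℂ (dslope (dslope k 0) 0) (ball 0 1) :=
    (Complex.differentiableOn_dslope h0).mpr hk1
  obtain ⟨C₁, hC₁⟩ := (isCompact_closedBall (0 : ℂ) r).exists_bound_of_continuousOn
    (hk1.continuousOn.mono hsub)
  obtain ⟨C₂, hC₂⟩ := (isCompact_closedBall (0 : ℂ) r).exists_bound_of_continuousOn
    (hk2.continuousOn.mono hsub)
  refine ⟨max 0 (max C₁ C₂), le_max_left _ _, fun z hz => ?_⟩
  have hz' : z ∈ closedBall (0 : ℂ) r := by simpa using hz
  have e1 : k z - k 0 = z * dslope k 0 z := by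
    simpa using (sub_smul_dslope k 0 z).symm
  have e2 : k z - k 0 - deriv k 0 * z = z ^ 2 * dslope (dslope k 0) 0 z := by
    have := sub_smul_dslope (dslope k 0) 0 z
    rw [sub_zero, smul_eq_mul, dslope_same] at this
    rw [e1, pow_two, mul_assoc, this]; ring
  constructor
  · rw [e1, norm_mul, mul_comm]
    gcongr
    exact (hC₁ z hz').trans ((le_max_left _ _).trans (le_max_right _ _))
  · rw [e2, norm_mul, norm_pow, mul_comm]
    gcongr
    exact (hC₂ z hz').trans ((le_max_right _ _).trans (le_max_right _ _))

/-- The annulus `ε ≤ ‖z‖ ≤ r` is mapped by `z⁻¹ + k z` into an almost optimal ellipse. -/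
theorem inv_add_mem_ellipse {z κ b : ℂ} {C ε : ℝ} (hC : 0 ≤ C) (hε : 0 < ε) (hz : ε ≤ ‖z‖)
    (hz1 : ‖z‖ ≤ 1) (hκ : ‖κ‖ ≤ C * ‖z‖) (hκb : ‖κ - b * z‖ ≤ C * ‖z‖ ^ 2)
    (hεC : 2 * (‖b‖ + C) * ε ≤ 1) :
    ‖(z⁻¹ + κ) - b * ε ^ 2 * (starRingEnd ℂ) (z⁻¹ + κ)‖ ≤ ε⁻¹ + (C + ‖b‖ * C) * ε ^ 2 := by
  set ρ := ‖z‖ with hρ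
  have hρ0 : 0 < ρ := hε.trans_le hz
  have hz0 : z ≠ 0 := norm_pos_iff.mp hρ0
  have hconj : (starRingEnd ℂ) z⁻¹ = z * (((ρ ^ 2)⁻¹ : ℝ) : ℂ) := by
    have h1 : z * (starRingEnd ℂ) z = (ρ : ℂ) ^ 2 := by
      rw [Complex.mul_conj, Complex.normSq_eq_norm_sq]; push_cast; ring
    have h2 : (starRingEnd ℂ) z ≠ 0 := by simpa using hz0
    rw [map_inv₀]; push_cast; rw [← h1]; field_simp
  have e : (z⁻¹ + κ) - b * ε ^ 2 * (starRingEnd ℂ) (z⁻¹ + κ) =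
      z⁻¹ + b * z * ((1 - ε ^ 2 / ρ ^ 2 : ℝ) : ℂ) + (κ - b * z) -
        b * ε ^ 2 * (starRingEnd ℂ) κ := by
    rw [map_add, hconj]; push_cast; ring
  have hnn : 0 ≤ 1 - ε ^ 2 / ρ ^ 2 := by
    rw [sub_nonneg, div_le_one (by positivity)]
    gcongr
  have n1 : ‖z⁻¹‖ = ρ⁻¹ := norm_inv z
  have n2 : ‖b * z * ((1 - ε ^ 2 / ρ ^ 2 : ℝ) : ℂ)‖ = ‖b‖ * (ρ * (1 - ε ^ 2 / ρ ^ 2)) := by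
    rw [norm_mul, norm_mul, Complex.norm_real, Real.norm_of_nonneg hnn, mul_assoc]
  have n3 : ‖b * (ε : ℂ) ^ 2 * (starRingEnd ℂ) κ‖ ≤ ‖b‖ * C * ε ^ 2 := by
    rw [norm_mul, norm_mul, norm_pow, Complex.norm_real, Real.norm_of_nonneg hε.le,
      RCLike.norm_conj]
    have : ‖κ‖ ≤ C := hκ.trans (mul_le_of_le_one_right hC hz1)
    calc ‖b‖ * ε ^ 2 * ‖κ‖ ≤ ‖b‖ * ε ^ 2 * C := by gcongr
      _ = _ := by ring
  have m1 : ρ⁻¹ = ε⁻¹ - (ρ - ε) / (ε * ρ) := by field_simp; ring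
  have m2 : ρ * (1 - ε ^ 2 / ρ ^ 2) ≤ 2 * (ρ - ε) := by
    have : ρ * (1 - ε ^ 2 / ρ ^ 2) = (ρ - ε) * ((ρ + ε) / ρ) := by field_simp; ring
    rw [this, mul_comm 2]
    refine mul_le_mul_of_nonneg_left ?_ (by linarith)
    rw [div_le_iff₀ hρ0]; linarith
  have m3 : C * ρ ^ 2 ≤ C * ε ^ 2 + 2 * C * (ρ - ε) := by
    nlinarith [mul_nonneg hC (sub_nonneg.mpr hz)]
  have m4 : 2 * (‖b‖ + C) * (ρ - ε) ≤ (ρ - ε) / (ε * ρ) := by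
    rw [le_div_iff₀ (by positivity)]
    have h1 : 2 * (‖b‖ + C) * (ε * ρ) ≤ 1 := by
      calc 2 * (‖b‖ + C) * (ε * ρ) = 2 * (‖b‖ + C) * ε * ρ := by ring
        _ ≤ 1 * 1 := mul_le_mul hεC hz1 hρ0.le zero_le_one
        _ = 1 := one_mul 1
    nlinarith
  have m5 := mul_le_mul_of_nonneg_left m2 (norm_nonneg b)
  rw [e]
  calc _ ≤ ‖z⁻¹‖ + ‖b * z * ((1 - ε ^ 2 / ρ ^ 2 : ℝ) : ℂ)‖ + ‖κ - b * z‖ +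
        ‖b * (ε : ℂ) ^ 2 * (starRingEnd ℂ) κ‖ :=
        (norm_sub_le _ _).trans (add_le_add_left (norm_add₃_le) _)
    _ ≤ _ := by rw [n1, n2]; linarith

theorem continuousOn_circleAverage {G : ℂ → ℝ} {ε r : ℝ} (hε : 0 < ε)
    (hG : ContinuousOn G {z | ε ≤ ‖z‖ ∧ ‖z‖ ≤ r}) :
    ContinuousOn (fun s => circleAverage G 0 s) (Icc ε r) := by
  rw [continuousOn_iff_continuous_domRestrict]
  refine continuous_const.mul
    (intervalIntegral.continuous_parametric_intervalIntegral_of_continuous' (μ := volume)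
      (f := fun (s : Icc ε r) θ => G (circleMap 0 s θ)) ?_ 0 (2 * π))
  refine hG.comp_continuous (f := fun p : Icc ε r × ℝ => circleMap 0 p.1 p.2) ?_ ?_
  · simp only [circleMap]; fun_prop
  · rintro ⟨⟨s, hs⟩, θ⟩
    have hs' : |s| = s := abs_of_pos (hε.trans_le hs.1)
    simp [hs', hs.1, hs.2]

theorem area_inequality {k : ℂ → ℂ} (hk : DifferentiableOn ℂ k (ball 0 1))
    (hinj : InjOn (fun z => z⁻¹ + k z) (ball 0 1 \ {0})) {r C ε : ℝ} (hr1 : r < 1) (hC : 0 ≤ C)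
    (hkC : ∀ z : ℂ, ‖z‖ ≤ r →
      ‖k z - k 0‖ ≤ C * ‖z‖ ∧ ‖k z - k 0 - deriv k 0 * z‖ ≤ C * ‖z‖ ^ 2)
    (hε : 0 < ε) (hεr : ε ≤ r) (hεC : 2 * (‖deriv k 0‖ + C) * ε ≤ 1)
    (hε1 : ‖deriv k 0‖ * ε ^ 2 < 1) :
    (ε ^ 2)⁻¹ - (r ^ 2)⁻¹ + ‖deriv k 0‖ ^ 2 * (r ^ 2 - ε ^ 2) ≤
      (ε⁻¹ + (C + ‖deriv k 0‖ * C) * ε ^ 2) ^ 2 / (1 - (‖deriv k 0‖ * ε ^ 2) ^ 2) := by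
  set b := deriv k 0 with hb
  set S : Set ℂ := {z | ε ≤ ‖z‖ ∧ ‖z‖ ≤ r} with hS
  have hSm : MeasurableSet S :=
    (measurableSet_le measurable_const measurable_norm).inter
      (measurableSet_le measurable_norm measurable_const)
  have hSK : IsCompact S := by
    refine (isCompact_closedBall (0 : ℂ) r).of_isClosed_subset
      ((isClosed_le continuous_const continuous_norm).inter
        (isClosed_le continuous_norm continuous_const)) fun z hz => ?_
    simpa using hz.2
  have hSsub : S ⊆ ball 0 1 \ {0} := by
    intro z hz
    refine ⟨by simpa using hz.2.trans_lt hr1, ?_⟩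
    exact norm_pos_iff.mp (hε.trans_le hz.1)
  have hdk : DifferentiableOn ℂ (deriv k) (ball 0 1) := hk.deriv isOpen_ball
  have hder : ∀ z ∈ S, HasDerivAt (fun z => z⁻¹ + k z) (-(z ^ 2)⁻¹ + deriv k z) z := by
    intro z hz
    exact (hasDerivAt_inv (hSsub hz).2).fun_add
      (hk.hasDerivAt (isOpen_ball.mem_nhds (hSsub hz).1))
  have hcont : ContinuousOn (fun z : ℂ => ‖-(z ^ 2)⁻¹ + deriv k z‖ ^ 2) S := by
    have hi : ContinuousOn (fun z : ℂ => (z ^ 2)⁻¹) S :=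
      (by fun_prop : ContinuousOn (fun z : ℂ => z ^ 2) S).inv₀ fun z hz =>
        pow_ne_zero 2 (hSsub hz).2
    exact ((hi.neg.add (hdk.continuousOn.mono fun z hz => (hSsub hz).1)).norm).pow 2
  have harea := volume_image_eq_lintegral_norm_deriv hSm hder (hinj.mono hSsub)
  rw [← ofReal_integral_eq_lintegral_ofReal (hcont.integrableOn_compact hSK)
    (Filter.Eventually.of_forall fun z => by positivity), integral_annulus hε hεr hcont] at harea
  have hsubE : (fun z => z⁻¹ + k z) '' S ⊆
      {w : ℂ | ‖(w - k 0) - b * ε ^ 2 * (starRingEnd ℂ) (w - k 0)‖ ≤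
        ε⁻¹ + (C + ‖b‖ * C) * ε ^ 2} := by
    rintro _ ⟨z, hz, rfl⟩
    have h1 := hkC z hz.2
    have := inv_add_mem_ellipse hC hε hz.1 (hz.2.trans hr1.le) h1.1 h1.2 hεC
    simpa [add_sub_assoc] using this
  have hc : ‖b * (ε : ℂ) ^ 2‖ = ‖b‖ * ε ^ 2 := by
    rw [norm_mul, norm_pow, Complex.norm_real, Real.norm_of_nonneg hε.le]
  have hvol := measure_mono (μ := volume) hsubE
  rw [harea, volume_ellipse (by rwa [hc]) (by positivity), hc] at hvol
  have hden : 0 < 1 - (‖b‖ * ε ^ 2) ^ 2 := by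
    have : 0 ≤ ‖b‖ * ε ^ 2 := by positivity
    nlinarith
  rw [ENNReal.ofReal_le_ofReal_iff (by positivity)] at hvol
  have hpos : ∀ s ∈ uIcc ε r, 0 < s := fun s hs => by
    rw [uIcc_of_le hεr] at hs; exact hε.trans_le hs.1
  have hinv : ContinuousOn (fun s : ℝ => (s ^ 4)⁻¹) (uIcc ε r) :=
    (by fun_prop : ContinuousOn (fun s : ℝ => s ^ 4) _).inv₀ fun s hs =>
      pow_ne_zero 4 (hpos s hs).ne'
  have hlow : ∫ s in ε..r, 2 * π * s * ((s ^ 4)⁻¹ + ‖b‖ ^ 2) ≤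
      ∫ s in ε..r, 2 * π * s *
        circleAverage (fun z => ‖-(z ^ 2)⁻¹ + deriv k z‖ ^ 2) 0 s := by
    have hl : ContinuousOn (fun s : ℝ => 2 * π * s) (uIcc ε r) := by fun_prop
    refine intervalIntegral.integral_mono_on hεr
      (hl.mul (hinv.add continuousOn_const)).intervalIntegrable
      (hl.mul ?_).intervalIntegrable fun s hs => ?_
    · rw [uIcc_of_le hεr]; exact continuousOn_circleAverage hε hcont
    · have hs0 : 0 < s := hε.trans_le hs.1
      exact mul_le_mul_of_nonneg_left (le_circleAverage_norm_sq hdk hs0 (hs.2.trans_lt hr1))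
        (by positivity)
  have hcalc : ∫ s in ε..r, 2 * π * s * ((s ^ 4)⁻¹ + ‖b‖ ^ 2) =
      π * ((ε ^ 2)⁻¹ - (r ^ 2)⁻¹ + ‖b‖ ^ 2 * (r ^ 2 - ε ^ 2)) := by
    rw [intervalIntegral.integral_eq_sub_of_hasDerivAt
      (f := fun s => π * (-(s ^ 2)⁻¹ + ‖b‖ ^ 2 * s ^ 2))]
    · ring
    · intro s hs
      have hs0 := (hpos s hs).ne'
      have h1 := (((hasDerivAt_pow 2 s).fun_inv (pow_ne_zero 2 hs0)).fun_neg.fun_add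
        ((hasDerivAt_pow 2 s).const_mul (‖b‖ ^ 2))).const_mul π
      refine h1.congr_deriv ?_
      push_cast
      field_simp
    · refine ContinuousOn.intervalIntegrable ?_
      exact (by fun_prop : ContinuousOn (fun s : ℝ => 2 * π * s) _).mul
        (hinv.add continuousOn_const)
  rw [hcalc] at hlow
  have := hlow.trans hvol
  rw [mul_div_assoc] at this
  exact le_of_mul_le_mul_left this pi_pos

open Filter Topology in
/-- The area theorem, in the form of the bound on the first coefficient. -/
theorem norm_deriv_le_one_of_injOn_inv_add {k : ℂ → ℂ} (hk : DifferentiableOn ℂ k (ball 0 1))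
    (hinj : InjOn (fun z => z⁻¹ + k z) (ball 0 1 \ {0})) : ‖deriv k 0‖ ≤ 1 := by
  set B := ‖deriv k 0‖ with hB
  have hB0 : 0 ≤ B := norm_nonneg _
  have key : ∀ r : ℝ, 0 < r → r < 1 → B ^ 2 * r ^ 4 ≤ 1 := by
    intro r hr hr1
    obtain ⟨C, hC, hkC⟩ := norm_sub_le_of_differentiableOn_ball hk hr1
    set D := C + B * C with hD
    have hev : ∀ᶠ ε : ℝ in 𝓝[>] 0,
        (1 - B ^ 2 * ε ^ 4) * (B ^ 2 * (r ^ 2 - ε ^ 2) - (r ^ 2)⁻¹) - B ^ 2 * ε ^ 2 ≤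
          2 * D * ε + D ^ 2 * ε ^ 4 := by
      have t1 : ∀ᶠ ε : ℝ in 𝓝[>] 0, 2 * (B + C) * ε < 1 := by
        refine nhdsWithin_le_nhds (ContinuousAt.eventually_lt (by fun_prop) (by fun_prop) ?_)
        norm_num
      have t2 : ∀ᶠ ε : ℝ in 𝓝[>] 0, B * ε ^ 2 < 1 := by
        refine nhdsWithin_le_nhds (ContinuousAt.eventually_lt (by fun_prop) (by fun_prop) ?_)
        norm_num
      have t3 : ∀ᶠ ε : ℝ in 𝓝[>] 0, ε < r := nhdsWithin_le_nhds (gt_mem_nhds hr)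
      filter_upwards [t1, t2, t3, self_mem_nhdsWithin] with ε h1 h2 h3 hε
      have hε : 0 < ε := hε
      have := area_inequality hk hinj hr1 hC hkC hε h3.le h1.le h2
      rw [← hB, ← hD, le_div_iff₀ (by
        have : 0 ≤ B * ε ^ 2 := by positivity
        nlinarith)] at this
      have e1 : (ε⁻¹ + D * ε ^ 2) ^ 2 = (ε ^ 2)⁻¹ + 2 * D * ε + D ^ 2 * ε ^ 4 := by
        field_simp; ring
      have e2 : (ε ^ 2)⁻¹ * (1 - (B * ε ^ 2) ^ 2) = (ε ^ 2)⁻¹ - B ^ 2 * ε ^ 2 := by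
        field_simp
      rw [e1] at this
      nlinarith
    have hlim := le_of_tendsto_of_tendsto
      (b := 𝓝[>] (0 : ℝ))
      (f := fun ε : ℝ =>
        (1 - B ^ 2 * ε ^ 4) * (B ^ 2 * (r ^ 2 - ε ^ 2) - (r ^ 2)⁻¹) - B ^ 2 * ε ^ 2)
      (g := fun ε : ℝ => 2 * D * ε + D ^ 2 * ε ^ 4)
      ((Continuous.tendsto (by fun_prop) 0).mono_left nhdsWithin_le_nhds)
      ((Continuous.tendsto (by fun_prop) 0).mono_left nhdsWithin_le_nhds) hev
    norm_num at hlim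
    have e : B ^ 2 * r ^ 4 = B ^ 2 * r ^ 2 * r ^ 2 := by ring
    rw [e, ← le_div_iff₀ (by positivity), one_div]
    exact hlim
  have hlim : B ^ 2 * 1 ^ 4 ≤ 1 := by
    refine le_of_tendsto (x := 𝓝[<] (1 : ℝ)) (f := fun r : ℝ => B ^ 2 * r ^ 4)
      ((Continuous.tendsto (by fun_prop) 1).mono_left nhdsWithin_le_nhds) ?_
    filter_upwards [nhdsWithin_le_nhds (lt_mem_nhds one_pos), self_mem_nhdsWithin] with r h1 h2
    exact key r h1 h2
  nlinarith

end AreaTheorem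

theorem exists_differentiableOn_sq_eq {φ : ℂ → ℂ} (hφ : DifferentiableOn ℂ φ (ball 0 1))
    (hφ0 : ∀ z ∈ ball (0 : ℂ) 1, φ z ≠ 0) :
    ∃ σ : ℂ → ℂ, DifferentiableOn ℂ σ (ball 0 1) ∧ ∀ z, σ z ^ 2 = φ z := by
  have hsc : IsSimplyConnected (ball (0 : ℂ) 1) := by
    have : ContractibleSpace (ball (0 : ℂ) 1) :=
      (convex_ball (0 : ℂ) 1).contractibleSpace ⟨0, mem_ball_self one_pos⟩
    exact SimplyConnectedSpace.ofContractible _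
  obtain ⟨σ, hσc, hσ⟩ := Complex.exists_continuousOn_pow_eq hsc isOpen_ball hφ.continuousOn
    (by rintro ⟨z, hz, h⟩; exact hφ0 z hz h) two_ne_zero
  refine ⟨σ, fun z hz => ?_, hσ⟩
  have hnhds := isOpen_ball.mem_nhds hz
  have hσz : σ z ≠ 0 := fun h => hφ0 z hz (by rw [← hσ, h]; simp)
  have hcont : ContinuousAt σ z := hσc.continuousAt hnhds
  have hsum : Filter.Tendsto (fun w => σ w + σ z) (nhdsWithin z {z}ᶜ) (nhds (σ z + σ z)) :=
    (hcont.add continuousAt_const).tendsto.mono_left nhdsWithin_le_nhds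
  have h2 : σ z + σ z ≠ 0 := by rw [← two_mul]; exact mul_ne_zero two_ne_zero hσz
  refine HasDerivAt.differentiableAt (f' := deriv φ z / (σ z + σ z)) ?_ |>.differentiableWithinAt
  rw [hasDerivAt_iff_tendsto_slope]
  refine (((hφ.hasDerivAt hnhds).tendsto_slope).div hsum h2).congr' ?_
  filter_upwards [hsum.eventually_ne h2] with w hw
  simp only [Pi.div_apply, slope_def_field, ← hσ]
  rw [div_div, mul_comm, ← div_div]
  congr 1
  rw [div_eq_iff hw]
  ring

/-- Bieberbach's bound on the second coefficient of a univalent function. -/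
theorem norm_deriv_deriv_le_of_injOn {f : ℂ → ℂ} (hf : DifferentiableOn ℂ f (ball 0 1))
    (hinj : InjOn f (ball 0 1)) : ‖deriv (deriv f) 0‖ ≤ 4 * ‖deriv f 0‖ := by
  have h0 : (0 : ℂ) ∈ ball (0 : ℂ) 1 := mem_ball_self one_pos
  have hn0 : ball (0 : ℂ) 1 ∈ nhds 0 := isOpen_ball.mem_nhds h0
  have hf' : deriv f 0 ≠ 0 := deriv_ne_zero_of_injOn isOpen_ball hf hinj h0
  set φ := dslope f 0 with hφdef
  have hφ : DifferentiableOn ℂ φ (ball 0 1) := (Complex.differentiableOn_dslope hn0).mpr hf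
  have hφ00 : φ 0 = deriv f 0 := dslope_same f 0
  have hfφ : ∀ z, f z = f 0 + z * φ z := fun z => by
    have := sub_smul_dslope f 0 z
    rw [sub_zero, smul_eq_mul] at this
    rw [this]; ring
  have hφne : ∀ z ∈ ball (0 : ℂ) 1, φ z ≠ 0 := by
    intro z hz hz0
    by_cases h : z = 0
    · rw [h, hφ00] at hz0; exact hf' hz0
    · exact h (hinj hz h0 (by rw [hfφ z, hz0]; ring))
  obtain ⟨σ, hσ, hσφ⟩ := exists_differentiableOn_sq_eq hφ hφne
  have hσne : ∀ z ∈ ball (0 : ℂ) 1, σ z ≠ 0 := fun z hz h => hφne z hz (by rw [← hσφ, h]; simp)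
  have hsq : ∀ z ∈ ball (0 : ℂ) 1, z ^ 2 ∈ ball (0 : ℂ) 1 := fun z hz => by
    rw [mem_ball_zero_iff] at hz ⊢
    rw [norm_pow]
    exact pow_lt_one₀ (norm_nonneg z) hz two_ne_zero
  set τ : ℂ → ℂ := fun z => σ 0 * (σ z)⁻¹ with hτdef
  have hτ : DifferentiableOn ℂ τ (ball 0 1) := (hσ.inv hσne).const_mul _
  have hτ0 : τ 0 = 1 := mul_inv_cancel₀ (hσne 0 h0)
  set T := dslope τ 0 with hTdef
  have hT : DifferentiableOn ℂ T (ball 0 1) := (Complex.differentiableOn_dslope hn0).mpr hτ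
  have hτT : ∀ z, τ z = 1 + z * T z := fun z => by
    have := sub_smul_dslope τ 0 z
    rw [sub_zero, smul_eq_mul] at this
    rw [this, hτ0]; ring
  have hk : DifferentiableOn ℂ (fun z => z * T (z ^ 2)) (ball 0 1) :=
    differentiableOn_id.mul (hT.comp (by fun_prop) hsq)
  have hkinv : ∀ z : ℂ, z ≠ 0 → z⁻¹ + z * T (z ^ 2) = σ 0 * (z * σ (z ^ 2))⁻¹ := fun z hz => by
    have := hτT (z ^ 2)
    simp only [hτdef] at this
    rw [mul_inv, mul_left_comm, this]
    field_simp
  have hbound := norm_deriv_le_one_of_injOn_inv_add hk (by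
    rintro z ⟨hz, hz0⟩ w ⟨hw, hw0⟩ h
    have hz0 : z ≠ 0 := hz0
    have hw0 : w ≠ 0 := hw0
    simp only [hkinv z hz0, hkinv w hw0] at h
    have h1 : z * σ (z ^ 2) = w * σ (w ^ 2) := inv_injective (mul_left_cancel₀ (hσne 0 h0) h)
    have h2 : z ^ 2 = w ^ 2 := by
      refine hinj (hsq z hz) (hsq w hw) ?_
      rw [hfφ, hfφ (w ^ 2), ← hσφ, ← hσφ, ← mul_pow, ← mul_pow, h1]
    rw [h2] at h1
    exact mul_right_cancel₀ (hσne _ (hsq w hw)) h1)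
  have hkd : deriv (fun z => z * T (z ^ 2)) 0 = T 0 := by
    have h1 : HasDerivAt (fun z : ℂ => T (z ^ 2)) (deriv T ((0 : ℂ) ^ 2) * (2 * 0)) 0 := by
      refine HasDerivAt.comp (h := fun z : ℂ => z ^ 2) 0 (hT.hasDerivAt ?_) ?_
      · simpa using hn0
      · simpa using hasDerivAt_pow 2 (0 : ℂ)
    have := ((hasDerivAt_id' (0 : ℂ)).fun_mul h1).deriv
    simpa using this
  have hσd : HasDerivAt σ (deriv σ 0) 0 := hσ.hasDerivAt hn0
  have hT0 : T 0 = -(deriv σ 0 / σ 0) := by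
    rw [hTdef, dslope_same, hτdef, ((hσd.fun_inv (hσne 0 h0)).const_mul (σ 0)).deriv]
    have := hσne 0 h0
    field_simp
  have hφd : deriv φ 0 = 2 * σ 0 * deriv σ 0 := by
    have h1 : φ = fun z => σ z ^ 2 := funext fun z => (hσφ z).symm
    rw [h1, (hσd.fun_pow 2).deriv]
    simp
  have hf2 : deriv (deriv f) 0 = 2 * deriv φ 0 := by
    have h1 : ∀ z ∈ ball (0 : ℂ) 1, deriv f z = φ z + z * deriv φ z := fun z hz => by
      have h2 : f = fun z => f 0 + z * φ z := funext hfφ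
      have h3 := ((hasDerivAt_id' z).fun_mul
        (hφ.hasDerivAt (isOpen_ball.mem_nhds hz))).const_add (f 0)
      rw [h2, h3.deriv]; ring
    have h3 : deriv f =ᶠ[nhds 0] fun z => φ z + z * deriv φ z :=
      Filter.eventually_of_mem hn0 h1
    rw [h3.deriv_eq, ((hφ.hasDerivAt hn0).fun_add ((hasDerivAt_id' (0 : ℂ)).fun_mul
      ((hφ.deriv isOpen_ball).hasDerivAt hn0))).deriv]
    ring
  rw [hkd, hT0, norm_neg, norm_div, div_le_one (norm_pos_iff.mpr (hσne 0 h0))] at hbound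
  rw [hf2, hφd, ← hφ00, ← hσφ 0, norm_mul, norm_mul, norm_mul, norm_pow]
  have : ‖(2 : ℂ)‖ = 2 := by simp
  rw [this]
  nlinarith [norm_nonneg (σ 0)]

theorem norm_deriv_le_four_mul_of_notMem {f : ℂ → ℂ} (hf : DifferentiableOn ℂ f (ball 0 1))
    (hinj : InjOn f (ball 0 1)) {w : ℂ} (hw : w ∉ f '' ball 0 1) :
    ‖deriv f 0‖ ≤ 4 * ‖w - f 0‖ := by
  have h0 : (0 : ℂ) ∈ ball (0 : ℂ) 1 := mem_ball_self one_pos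
  have hn0 : ball (0 : ℂ) 1 ∈ nhds 0 := isOpen_ball.mem_nhds h0
  have hne : ∀ z ∈ ball (0 : ℂ) 1, w - f z ≠ 0 := fun z hz h =>
    hw ⟨z, hz, (sub_eq_zero.mp h).symm⟩
  have hF : DifferentiableOn ℂ (fun z => (w - f z)⁻¹) (ball 0 1) :=
    (hf.const_sub w).inv hne
  have hFinj : InjOn (fun z => (w - f z)⁻¹) (ball 0 1) := fun z hz z' hz' h =>
    hinj hz hz' (sub_right_injective (inv_injective h))
  have hfd : ∀ z ∈ ball (0 : ℂ) 1, HasDerivAt f (deriv f z) z := fun z hz =>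
    hf.hasDerivAt (isOpen_ball.mem_nhds hz)
  have hFd : ∀ z ∈ ball (0 : ℂ) 1,
      deriv (fun z => (w - f z)⁻¹) z = deriv f z * ((w - f z)⁻¹) ^ 2 := fun z hz => by
    rw [(((hfd z hz).const_sub w).fun_inv (hne z hz)).deriv, neg_neg, inv_pow, div_eq_mul_inv]
  have hFdd : deriv (deriv fun z => (w - f z)⁻¹) 0 =
      deriv (deriv f) 0 * ((w - f 0)⁻¹) ^ 2 + 2 * deriv f 0 ^ 2 * ((w - f 0)⁻¹) ^ 3 := by
    have h1 : deriv (fun z => (w - f z)⁻¹) =ᶠ[nhds 0] fun z => deriv f z * ((w - f z)⁻¹) ^ 2 :=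
      Filter.eventually_of_mem hn0 hFd
    rw [h1.deriv_eq, (((hf.deriv isOpen_ball).hasDerivAt hn0).fun_mul
      ((((hfd 0 h0).const_sub w).fun_inv (hne 0 h0)).fun_pow 2)).deriv]
    push_cast
    have := hne 0 h0
    field_simp
  have b1 := norm_deriv_deriv_le_of_injOn hf hinj
  have b2 := norm_deriv_deriv_le_of_injOn hF hFinj
  rw [hFdd, hFd 0 h0] at b2
  have hc : 0 < ‖w - f 0‖ := norm_pos_iff.mpr (hne 0 h0)
  set D := ‖deriv f 0‖ with hD
  set c := ‖w - f 0‖ with hcdef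
  have b3 : ‖2 * deriv f 0 ^ 2 * ((w - f 0)⁻¹) ^ 3‖ ≤ 4 * (D * (c⁻¹) ^ 2) + 4 * D * (c⁻¹) ^ 2 := by
    have e := norm_sub_le
      (deriv (deriv f) 0 * ((w - f 0)⁻¹) ^ 2 + 2 * deriv f 0 ^ 2 * ((w - f 0)⁻¹) ^ 3)
      (deriv (deriv f) 0 * ((w - f 0)⁻¹) ^ 2)
    rw [add_sub_cancel_left] at e
    refine e.trans (add_le_add ?_ ?_)
    · refine b2.trans_eq ?_
      rw [norm_mul, norm_pow, norm_inv]
    · rw [norm_mul, norm_pow, norm_inv]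
      gcongr
  rw [norm_mul, norm_mul, norm_pow, norm_pow, norm_inv, Complex.norm_ofNat, ← hD, ← hcdef] at b3
  rcases (norm_nonneg (deriv f 0)).eq_or_lt with h | h
  · rw [hD, ← h]; positivity
  · rw [← hD] at h
    have e1 : 2 * D ^ 2 * c⁻¹ ^ 3 = (2 * D * c⁻¹ ^ 3) * D := by ring
    have e2 : 4 * (D * (c⁻¹) ^ 2) + 4 * D * (c⁻¹) ^ 2 = (2 * D * c⁻¹ ^ 3) * (4 * c) := by
      field_simp; ring
    rw [e1, e2] at b3
    exact le_of_mul_le_mul_left b3 (by positivity)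

/-- Rescaling a univalent function to the unit disc. -/
theorem univalent_comp_affine {f : ℂ → ℂ} {a c : ℂ} (hf : DifferentiableOn ℂ f (ball a ‖c‖))
    (hinj : InjOn f (ball a ‖c‖)) (hc : c ≠ 0) :
    DifferentiableOn ℂ (fun z => f (a + c * z)) (ball 0 1) ∧
      InjOn (fun z => f (a + c * z)) (ball 0 1) ∧
      deriv (fun z => f (a + c * z)) 0 = deriv f a * c := by
  have hc0 : 0 < ‖c‖ := norm_pos_iff.mpr hc
  have hmaps : MapsTo (fun z => a + c * z) (ball 0 1) (ball a ‖c‖) := fun z hz => by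
    rw [mem_ball_zero_iff] at hz
    rw [mem_ball, dist_eq_norm, add_sub_cancel_left, norm_mul]
    exact mul_lt_of_lt_one_right hc0 hz
  refine ⟨hf.comp (by fun_prop) hmaps, fun z hz z' hz' h => ?_, ?_⟩
  · exact mul_left_cancel₀ hc (add_left_cancel (hinj (hmaps hz) (hmaps hz') h))
  · have h1 : HasDerivAt f (deriv f a) (a + c * 0) := by
      rw [mul_zero, add_zero]; exact hf.hasDerivAt (ball_mem_nhds a hc0)
    have h2 : HasDerivAt (fun z => a + c * z) c 0 := by
      simpa using ((hasDerivAt_id' (0 : ℂ)).const_mul c).const_add a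
    exact (h1.comp 0 h2).deriv

/-- The Koebe one-quarter theorem. -/
theorem ball_subset_image_of_injOn {f : ℂ → ℂ} {a : ℂ} {R : ℝ} (hR : 0 < R)
    (hf : DifferentiableOn ℂ f (ball a R)) (hinj : InjOn f (ball a R)) :
    ball (f a) (‖deriv f a‖ * R / 4) ⊆ f '' ball a R := by
  intro w hw
  by_contra hwn
  have hRn : ‖(R : ℂ)‖ = R := by simp [hR.le]
  have hRc : (R : ℂ) ≠ 0 := by exact_mod_cast hR.ne'
  obtain ⟨h1, h2, h3⟩ := univalent_comp_affine (c := (R : ℂ)) (by rwa [hRn]) (by rwa [hRn]) hRc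
  have := norm_deriv_le_four_mul_of_notMem h1 h2 (w := w) (by
    rintro ⟨z, hz, rfl⟩
    refine hwn ⟨a + R * z, ?_, rfl⟩
    rw [mem_ball_zero_iff] at hz
    rw [mem_ball, dist_eq_norm, add_sub_cancel_left, norm_mul, hRn]
    exact mul_lt_of_lt_one_right hR hz)
  rw [h3, norm_mul, hRn, mul_zero, add_zero] at this
  rw [mem_ball, dist_eq_norm] at hw
  linarith

theorem norm_deriv_deriv_sub_le {f : ℂ → ℂ} (hf : DifferentiableOn ℂ f (ball 0 1))
    (hinj : InjOn f (ball 0 1)) {s : ℝ} (hs : 0 ≤ s) (hs1 : s < 1) :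
    ‖(1 - s ^ 2 : ℂ) * deriv (deriv f) s - 2 * s * deriv f s‖ ≤ 4 * ‖deriv f s‖ := by
  have h0 : (0 : ℂ) ∈ ball (0 : ℂ) 1 := mem_ball_self one_pos
  have hn0 : ball (0 : ℂ) 1 ∈ nhds 0 := isOpen_ball.mem_nhds h0
  have hss : 0 < 1 - s ^ 2 := by nlinarith
  have hssc : (1 - s ^ 2 : ℂ) ≠ 0 := by exact_mod_cast hss.ne'
  have hsb : (s : ℂ) ∈ ball (0 : ℂ) 1 := by simpa [abs_of_nonneg hs] using hs1
  have hne : ∀ z ∈ ball (0 : ℂ) 1, (1 + s * z : ℂ) ≠ 0 := fun z hz h => by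
    rw [mem_ball_zero_iff] at hz
    have : (s * z : ℂ) = -1 := by linear_combination h
    have h2 := congrArg norm this
    rw [norm_mul, Complex.norm_real, Real.norm_of_nonneg hs, norm_neg, norm_one] at h2
    nlinarith [norm_nonneg z]
  set φ : ℂ → ℂ := fun z => (z + s) / (1 + s * z) with hφ
  have hφmaps : MapsTo φ (ball 0 1) (ball 0 1) := fun z hz => by
    have hp : 0 < ‖(1 + s * z : ℂ)‖ := norm_pos_iff.mpr (hne z hz)
    rw [mem_ball_zero_iff] at hz ⊢
    rw [hφ, norm_div, div_lt_one hp]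
    refine lt_of_pow_lt_pow_left₀ 2 hp.le ?_
    have hz2 : ‖z‖ ^ 2 < 1 := pow_lt_one₀ (norm_nonneg z) hz two_ne_zero
    rw [← Complex.normSq_eq_norm_sq, Complex.normSq_apply] at hz2
    rw [← Complex.normSq_eq_norm_sq, ← Complex.normSq_eq_norm_sq, Complex.normSq_apply,
      Complex.normSq_apply]
    simp
    nlinarith
  have hφd : ∀ z ∈ ball (0 : ℂ) 1, HasDerivAt φ ((1 - s ^ 2) * ((1 + s * z)⁻¹) ^ 2) z := by
    intro z hz
    have h1 : HasDerivAt (fun z : ℂ => 1 + s * z) (s : ℂ) z := by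
      simpa using ((hasDerivAt_id' z).const_mul (s : ℂ)).const_add 1
    refine (((hasDerivAt_id' z).add_const (s : ℂ)).fun_div h1 (hne z hz)).congr_deriv ?_
    have := hne z hz
    field_simp
    ring
  have hφinj : InjOn φ (ball 0 1) := fun z hz z' hz' h => by
    simp only [hφ] at h
    rw [div_eq_div_iff (hne z hz) (hne z' hz')] at h
    have : (1 - s ^ 2 : ℂ) * z = (1 - s ^ 2) * z' := by linear_combination h
    exact mul_left_cancel₀ hssc this
  have hφ0 : φ 0 = s := by simp [hφ]
  have hfd : ∀ z ∈ ball (0 : ℂ) 1, HasDerivAt f (deriv f z) z := fun z hz =>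
    hf.hasDerivAt (isOpen_ball.mem_nhds hz)
  have hg : DifferentiableOn ℂ (f ∘ φ) (ball 0 1) :=
    hf.comp (fun z hz => (hφd z hz).differentiableAt.differentiableWithinAt) hφmaps
  have hgd : ∀ z ∈ ball (0 : ℂ) 1,
      deriv (f ∘ φ) z = deriv f (φ z) * ((1 - s ^ 2) * ((1 + s * z)⁻¹) ^ 2) := fun z hz =>
    ((hfd _ (hφmaps hz)).comp z (hφd z hz)).deriv
  have hgdd : deriv (deriv (f ∘ φ)) 0 =
      (1 - s ^ 2) * ((1 - s ^ 2) * deriv (deriv f) s - 2 * s * deriv f s) := by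
    have h1 : deriv (f ∘ φ) =ᶠ[nhds 0]
        fun z => deriv f (φ z) * ((1 - s ^ 2) * ((1 + s * z)⁻¹) ^ 2) :=
      Filter.eventually_of_mem hn0 hgd
    have h2 : HasDerivAt (fun z => deriv f (φ z))
        (deriv (deriv f) (φ 0) * ((1 - s ^ 2) * ((1 + s * (0 : ℂ))⁻¹) ^ 2)) 0 :=
      HasDerivAt.comp 0 ((hf.deriv isOpen_ball).hasDerivAt
        (isOpen_ball.mem_nhds (hφmaps h0))) (hφd 0 h0)
    have h3 : HasDerivAt (fun z : ℂ => 1 + s * z) (s : ℂ) 0 := by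
      simpa using ((hasDerivAt_id' (0 : ℂ)).const_mul (s : ℂ)).const_add 1
    rw [h1.deriv_eq, (h2.fun_mul (((h3.fun_inv (hne 0 h0)).fun_pow 2).const_mul _)).deriv, hφ0]
    simp
    ring
  have hb := norm_deriv_deriv_le_of_injOn hg (hinj.comp hφinj hφmaps)
  rw [hgdd, hgd 0 h0, hφ0] at hb
  simp only [mul_zero, add_zero, inv_one, one_pow, mul_one] at hb
  rw [norm_mul, norm_mul, ← mul_assoc, mul_comm (4 * _)] at hb
  exact le_of_mul_le_mul_left hb (norm_pos_iff.mpr hssc)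

theorem norm_deriv_le_of_injOn {f : ℂ → ℂ} (hf : DifferentiableOn ℂ f (ball 0 1))
    (hinj : InjOn f (ball 0 1)) {s : ℝ} (hs : 0 ≤ s) (hs1 : s < 1) :
    ‖deriv f s‖ ≤ ‖deriv f 0‖ * ((1 + s) / (1 - s) ^ 3) := by
  have hmem : ∀ x ∈ Icc 0 s, (x : ℂ) ∈ ball (0 : ℂ) 1 := fun x hx => by
    simpa [abs_of_nonneg hx.1] using hx.2.trans_lt hs1
  set c : ℝ → ℝ := fun x => (1 - x) ^ 3 / (1 + x) with hc
  have hcd : ∀ x ∈ Icc 0 s, HasDerivAt c (-(c x * ((4 + 2 * x) / (1 - x ^ 2)))) x := by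
    intro x hx
    have h1 : 1 + x ≠ 0 := by linarith [hx.1]
    have h2 : 1 - x ≠ 0 := by linarith [hx.2]
    have h3 : 1 - x ^ 2 ≠ 0 := by
      rw [show 1 - x ^ 2 = (1 + x) * (1 - x) by ring]; exact mul_ne_zero h1 h2
    refine ((((hasDerivAt_id' x).const_sub 1).fun_pow 3).fun_div
      ((hasDerivAt_id' x).const_add 1) h1).congr_deriv ?_
    rw [hc, show 1 - x ^ 2 = (1 + x) * (1 - x) by ring]
    push_cast
    field_simp
    ring
  have hd : ∀ x ∈ Icc 0 s, HasDerivAt (fun x : ℝ => ‖c x • deriv f x‖ ^ 2)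
      (2 * inner ℝ (c x • deriv f x) (c x • deriv (deriv f) x +
        (-(c x * ((4 + 2 * x) / (1 - x ^ 2)))) • deriv f x)) x := by
    intro x hx
    have h1 : HasDerivAt (fun x : ℝ => deriv f x) (deriv (deriv f) x) x :=
      ((hf.deriv isOpen_ball).hasDerivAt (isOpen_ball.mem_nhds (hmem x hx))).comp_ofReal
    exact ((hcd x hx).smul h1).norm_sq
  have hanti : AntitoneOn (fun x : ℝ => ‖c x • deriv f x‖ ^ 2) (Icc 0 s) := by
    refine antitoneOn_of_hasDerivWithinAt_nonpos (convex_Icc 0 s)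
      (fun x hx => (hd x hx).continuousAt.continuousWithinAt)
      (fun x hx => (hd x (interior_subset hx)).hasDerivWithinAt) fun x hx => ?_
    have hx := interior_subset hx
    have hx2 : 0 < 1 - x ^ 2 := by nlinarith [hx.1, hx.2]
    have hb := norm_deriv_deriv_sub_le hf hinj hx.1 (hx.2.trans_lt hs1)
    have hi := (real_inner_le_norm (deriv f x)
      ((1 - x ^ 2 : ℂ) * deriv (deriv f) x - 2 * x * deriv f x)).trans
      (mul_le_mul_of_nonneg_left hb (norm_nonneg _))
    have e1 : ((1 - x ^ 2 : ℂ) * deriv (deriv f) x - 2 * x * deriv f x) =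
        (1 - x ^ 2 : ℝ) • deriv (deriv f) x - (2 * x : ℝ) • deriv f x := by
      simp
    rw [e1, inner_sub_right, real_inner_smul_right, real_inner_smul_right,
      real_inner_self_eq_norm_sq] at hi
    rw [inner_add_right, real_inner_smul_right, real_inner_smul_right, real_inner_smul_left,
      real_inner_smul_left, real_inner_self_eq_norm_sq]
    have e2 : 2 * (c x * (c x * inner ℝ (deriv f x) (deriv (deriv f) x)) +
        -(c x * ((4 + 2 * x) / (1 - x ^ 2))) * (c x * ‖deriv f x‖ ^ 2)) =
        2 * c x ^ 2 / (1 - x ^ 2) * ((1 - x ^ 2) * inner ℝ (deriv f x) (deriv (deriv f) x) -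
          (4 + 2 * x) * ‖deriv f x‖ ^ 2) := by
      field_simp
      ring
    rw [e2]
    exact mul_nonpos_of_nonneg_of_nonpos (by positivity) (by nlinarith)
  have h := hanti ⟨le_rfl, hs⟩ ⟨hs, le_rfl⟩ hs
  simp only [norm_smul, Complex.ofReal_zero] at h
  have h := le_of_sq_le_sq h (by positivity)
  have hc0 : c 0 = 1 := by simp [hc]
  have hs' : 0 < 1 - s := by linarith
  have hcs : 0 < c s := by simp only [hc]; positivity
  rw [hc0, norm_one, one_mul, Real.norm_of_nonneg hcs.le, mul_comm, ← le_div_iff₀ hcs] at h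
  refine h.trans_eq ?_
  simp only [hc]
  field_simp

theorem norm_sub_le_of_injOn_unitBall {f : ℂ → ℂ} (hf : DifferentiableOn ℂ f (ball 0 1))
    (hinj : InjOn f (ball 0 1)) {s : ℝ} (hs : 0 ≤ s) (hs1 : s < 1) :
    ‖f s - f 0‖ ≤ ‖deriv f 0‖ * (s / (1 - s) ^ 2) := by
  have hmem : ∀ x ∈ Icc 0 s, (x : ℂ) ∈ ball (0 : ℂ) 1 := fun x hx => by
    simpa [abs_of_nonneg hx.1] using hx.2.trans_lt hs1
  have hfd : ∀ x ∈ Icc 0 s, HasDerivAt (fun x : ℝ => f x - f 0) (deriv f x) x := fun x hx =>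
    ((hf.hasDerivAt (isOpen_ball.mem_nhds (hmem x hx))).comp_ofReal).sub_const _
  have hB : ∀ x ∈ Icc 0 s, HasDerivAt (fun x : ℝ => ‖deriv f 0‖ * (x / (1 - x) ^ 2))
      (‖deriv f 0‖ * ((1 + x) / (1 - x) ^ 3)) x := by
    intro x hx
    have h2 : 1 - x ≠ 0 := by linarith [hx.2]
    refine (((hasDerivAt_id' x).fun_div (((hasDerivAt_id' x).const_sub 1).fun_pow 2)
      (pow_ne_zero 2 h2)).const_mul _).congr_deriv ?_
    push_cast
    field_simp
    ring
  exact image_norm_le_of_norm_deriv_right_le_deriv_boundary'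
    (fun x hx => (hfd x hx).continuousAt.continuousWithinAt)
    (fun x hx => (hfd x (Ico_subset_Icc_self hx)).hasDerivWithinAt) (by simp)
    (fun x hx => (hB x hx).continuousAt.continuousWithinAt)
    (fun x hx => (hB x (Ico_subset_Icc_self hx)).hasDerivWithinAt)
    (fun x hx => norm_deriv_le_of_injOn hf hinj hx.1 (hx.2.trans hs1)) ⟨hs, le_rfl⟩

/-- The growth theorem. -/
theorem norm_sub_le_of_injOn {f : ℂ → ℂ} {a z : ℂ} {R s : ℝ} (hR : 0 < R)
    (hf : DifferentiableOn ℂ f (ball a R)) (hinj : InjOn f (ball a R)) (hs : 0 ≤ s) (hs1 : s < 1)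
    (hz : ‖z - a‖ = s * R) :
    ‖f z - f a‖ ≤ ‖deriv f a‖ * R * (s / (1 - s) ^ 2) := by
  obtain ⟨c, hc, hcz⟩ : ∃ c : ℂ, ‖c‖ = R ∧ a + c * s = z := by
    rcases hs.eq_or_lt with rfl | hs0
    · rw [zero_mul, norm_eq_zero, sub_eq_zero] at hz
      exact ⟨R, by simp [hR.le], by simp [hz]⟩
    · have hsc : (s : ℂ) ≠ 0 := by exact_mod_cast hs0.ne'
      refine ⟨(z - a) / s, ?_, by field_simp; ring⟩
      rw [norm_div, hz, Complex.norm_real, Real.norm_of_nonneg hs]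
      field_simp
  obtain ⟨h1, h2, h3⟩ := univalent_comp_affine (c := c) (by rwa [hc]) (by rwa [hc])
    (norm_pos_iff.mp (by rwa [hc]))
  have := norm_sub_le_of_injOn_unitBall h1 h2 hs hs1
  rwa [h3, norm_mul, hc, hcz, mul_zero, add_zero] at this

namespace HolIFS

variable {S : HolIFS} {A : Set ℂ}

theorem word_nil : S.word [] = id := rfl

theorem word_cons (i : Fin S.m) (w : List (Fin S.m)) : S.word (i :: w) = S.g i ∘ S.word w := rfl

theorem word_append (u v : List (Fin S.m)) : S.word (u ++ v) = S.word u ∘ S.word v := by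
  induction u with
  | nil => rfl
  | cons i u ih => rw [List.cons_append, word_cons, word_cons, ih, Function.comp_assoc]

theorem mapsTo_g (i : Fin S.m) : MapsTo (S.g i) S.Ω S.Ω := fun _ hz =>
  S.hcl i (subset_closure (mem_image_of_mem _ hz))

theorem mapsTo_word (w : List (Fin S.m)) : MapsTo (S.word w) S.Ω S.Ω := by
  induction w with
  | nil => exact mapsTo_id _
  | cons i w ih => exact (mapsTo_g i).comp ih

theorem differentiableOn_word (w : List (Fin S.m)) : DifferentiableOn ℂ (S.word w) S.Ω := by
  induction w with
  | nil => exact differentiableOn_id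
  | cons i w ih => exact (S.hdiff i).comp ih (mapsTo_word w)

theorem injOn_word (w : List (Fin S.m)) : InjOn (S.word w) S.Ω := by
  induction w with
  | nil => exact injOn_id _
  | cons i w ih => exact (S.hinj i).comp ih (mapsTo_word w)

theorem differentiableAt_word (w : List (Fin S.m)) {x : ℂ} (hx : x ∈ S.Ω) :
    DifferentiableAt ℂ (S.word w) x :=
  (differentiableOn_word w).differentiableAt (S.hopen.mem_nhds hx)

theorem deriv_word_ne_zero (w : List (Fin S.m)) {x : ℂ} (hx : x ∈ S.Ω) :
    deriv (S.word w) x ≠ 0 :=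
  deriv_ne_zero_of_injOn S.hopen (differentiableOn_word w) (injOn_word w) hx

theorem deriv_word_append (u v : List (Fin S.m)) {x : ℂ} (hx : x ∈ S.Ω) :
    deriv (S.word (u ++ v)) x = deriv (S.word u) (S.word v x) * deriv (S.word v) x := by
  rw [word_append]
  exact deriv_comp x (differentiableAt_word u (mapsTo_word v hx)) (differentiableAt_word v hx)

theorem IsAttractor.mapsTo_word (hA : S.IsAttractor A) (w : List (Fin S.m)) :
    MapsTo (S.word w) A A := by
  induction w with
  | nil => exact mapsTo_id _
  | cons i w ih =>
    intro z hz
    rw [hA.2.2.2]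
    exact mem_iUnion_of_mem i (mem_image_of_mem _ (ih hz))

theorem IsAttractor.exists_preimage (hA : S.IsAttractor A) {x : ℂ} (hx : x ∈ A) :
    ∃ j : Fin S.m, ∃ y ∈ A, S.g j y = x := by
  rw [hA.2.2.2] at hx
  simpa using hx

theorem IsAttractor.exists_word_preimage (hA : S.IsAttractor A) {x : ℂ} (hx : x ∈ A) (n : ℕ) :
    ∃ w : List (Fin S.m), w.length = n ∧ ∃ y ∈ A, S.word w y = x := by
  induction n with
  | zero => exact ⟨[], rfl, x, hx, rfl⟩
  | succ n ih =>
    obtain ⟨w, hw, y, hy, rfl⟩ := ih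
    obtain ⟨j, z, hz, rfl⟩ := hA.exists_preimage hy
    exact ⟨w ++ [j], by simp [hw], z, hz, by rw [word_append]; rfl⟩

/-- The Earle–Hamilton contraction estimate, phrased through test functions into the disc. -/
theorem exists_norm_deriv_comp_word_le (S : HolIFS) :
    ∃ μ : ℝ, 0 < μ ∧ μ < 1 ∧ ∀ (w : List (Fin S.m)) (f : ℂ → ℂ),
      DifferentiableOn ℂ f S.Ω → MapsTo f S.Ω (closedBall 0 1) → ∀ (x : ℂ) (s : ℝ), 0 < s →
      closedBall x s ⊆ S.Ω →
      ‖deriv f (S.word w x) * deriv (S.word w) x‖ ≤ s⁻¹ * μ ^ w.length := by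
  obtain ⟨ε, hε, hthick⟩ := (isCompact_iUnion fun i : Fin S.m =>
    (S.hbdd.subset ((mapsTo_g i).image_subset)).isCompact_closure).exists_thickening_subset_open
      S.hopen (iUnion_subset S.hcl)
  obtain ⟨R, hR, hdist⟩ := S.hbdd.exists_pos_norm_le
  set t : ℝ := ε / (4 * R) with ht
  have ht0 : 0 < t := by positivity
  refine ⟨(1 + t)⁻¹, by positivity, inv_lt_one_of_one_lt₀ (by linarith), fun w => ?_⟩
  induction w with
  | nil =>
    intro f hf hmaps x s hs hxs
    have hb := Complex.norm_deriv_le_of_forall_mem_sphere_norm_le (C := 1) hs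
      ((hf.mono hxs).diffContOnCl_ball Subset.rfl)
      fun z hz => by simpa using hmaps (hxs (sphere_subset_closedBall hz))
    simpa [word_nil] using hb
  | cons i w ih =>
    intro f hf hmaps x s hs hxs
    have hx : x ∈ S.Ω := hxs (mem_closedBall_self hs.le)
    set p := S.word w x with hp
    have hpΩ : p ∈ S.Ω := mapsTo_word w hx
    set q : ℂ → ℂ := fun y => S.g i y + t * (S.g i y - S.g i p) with hq
    have hqmaps : MapsTo q S.Ω S.Ω := fun y hy => by
      refine hthick (mem_thickening_iff.mpr ⟨S.g i y,
        mem_iUnion_of_mem i (subset_closure (mem_image_of_mem _ hy)), ?_⟩)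
      have h1 : ‖S.g i y - S.g i p‖ ≤ R + R :=
        (norm_sub_le _ _).trans (add_le_add (hdist _ (mapsTo_g i hy)) (hdist _ (mapsTo_g i hpΩ)))
      rw [hq, dist_eq_norm, add_sub_cancel_left, norm_mul, Complex.norm_real,
        Real.norm_of_nonneg ht0.le]
      calc t * ‖S.g i y - S.g i p‖ ≤ t * (R + R) := by gcongr
        _ = ε / 2 := by rw [ht]; field_simp; ring
        _ < ε := by linarith
    have hgd : HasDerivAt (S.g i) (deriv (S.g i) p) p :=
      (S.hdiff i).hasDerivAt (S.hopen.mem_nhds hpΩ)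
    have hqd : HasDerivAt q (deriv (S.g i) p + t * deriv (S.g i) p) p :=
      hgd.fun_add ((hgd.sub_const _).const_mul _)
    have hqp : q p = S.g i p := by simp [hq]
    have hqdiff : DifferentiableOn ℂ q S.Ω :=
      (S.hdiff i).add (((S.hdiff i).sub_const _).const_mul _)
    have hfd : HasDerivAt f (deriv f (S.g i p)) (S.g i p) :=
      hf.hasDerivAt (S.hopen.mem_nhds (mapsTo_g i hpΩ))
    have h := ih (f ∘ q) (hf.comp hqdiff hqmaps) (hmaps.comp hqmaps) x s hs hxs
    rw [← hp, ((hqp ▸ hfd : HasDerivAt f (deriv f (S.g i p)) (q p)).comp p hqd).deriv] at h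
    have e1 : deriv (S.word (i :: w)) x = deriv (S.g i) p * deriv (S.word w) x :=
      deriv_word_append [i] w hx
    have e2 : deriv f (S.g i p) * (deriv (S.g i) p + t * deriv (S.g i) p) * deriv (S.word w) x =
        ((1 + t : ℝ) : ℂ) * (deriv f (S.g i p) * (deriv (S.g i) p * deriv (S.word w) x)) := by
      push_cast; ring
    rw [e2, norm_mul, Complex.norm_real, Real.norm_of_nonneg (by positivity)] at h
    rw [e1, List.length_cons, pow_succ, ← mul_assoc (s⁻¹), ← div_eq_mul_inv,
      le_div_iff₀ (by positivity), mul_comm]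
    exact h

theorem exists_norm_deriv_word_le (S : HolIFS) :
    ∃ μ R : ℝ, 0 < μ ∧ μ < 1 ∧ 0 < R ∧ ∀ (w : List (Fin S.m)) (x : ℂ) (s : ℝ), 0 < s →
      closedBall x s ⊆ S.Ω → ‖deriv (S.word w) x‖ ≤ R * s⁻¹ * μ ^ w.length := by
  obtain ⟨μ, h0, h1, h⟩ := exists_norm_deriv_comp_word_le S
  obtain ⟨R, hR, hdist⟩ := S.hbdd.exists_pos_norm_le
  refine ⟨μ, R, h0, h1, hR, fun w x s hs hxs => ?_⟩
  have := h w (fun z => (R : ℂ)⁻¹ * z) (by fun_prop) (fun z hz => by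
    rw [mem_closedBall_zero_iff, norm_mul, norm_inv, Complex.norm_real, Real.norm_of_nonneg hR.le,
      inv_mul_le_iff₀ hR, mul_one]
    exact hdist z hz) x s hs hxs
  rw [deriv_const_mul_field, deriv_id'', mul_one, norm_mul, norm_inv, Complex.norm_real,
    Real.norm_of_nonneg hR.le, inv_mul_le_iff₀ hR, ← mul_assoc] at this
  exact this

/-- All the maps `g_w` contract pairs of points of a compact subset of the domain at a
uniform exponential rate. -/
theorem exists_norm_word_sub_le (S : HolIFS) {A : Set ℂ} (hAc : IsCompact A) (hAΩ : A ⊆ S.Ω) :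
    ∃ μ C : ℝ, 0 < μ ∧ μ < 1 ∧ ∀ x ∈ A, ∀ y ∈ A, ∀ w : List (Fin S.m),
      ‖S.word w x - S.word w y‖ ≤ C * μ ^ w.length := by
  obtain ⟨μ, R, h0, h1, hR, h⟩ := exists_norm_deriv_word_le S
  have hloc : ∀ x ∈ S.Ω, ∃ s > 0, ∃ C : ℝ, ∀ y ∈ ball x s, ∀ w : List (Fin S.m),
      ‖S.word w x - S.word w y‖ ≤ C * μ ^ w.length := by
    intro x hx
    obtain ⟨s, hs, hsub⟩ := nhds_basis_closedBall.mem_iff.mp (S.hopen.mem_nhds hx)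
    have hsub' : ∀ y ∈ ball x (s / 2), closedBall y (s / 2) ⊆ S.Ω := fun y hy =>
      (closedBall_subset_closedBall' (by linarith [mem_ball.mp hy])).trans hsub
    refine ⟨s / 2, by positivity, R * (s / 2)⁻¹ * (s / 2), fun y hy w => ?_⟩
    have hd := Convex.norm_image_sub_le_of_norm_deriv_le
      (fun z hz => differentiableAt_word w (hsub' z hz (mem_closedBall_self (by positivity))))
      (fun z hz => h w z (s / 2) (by positivity) (hsub' z hz)) (convex_ball x (s / 2)) hy
      (mem_ball_self (by positivity))
    refine hd.trans ?_
    have : ‖x - y‖ ≤ s / 2 := by rw [← dist_eq_norm, dist_comm]; exact (mem_ball.mp hy).le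
    calc _ ≤ R * (s / 2)⁻¹ * μ ^ w.length * (s / 2) := by gcongr
      _ = _ := by ring
  have hpair : ∀ x ∈ S.Ω, ∀ y ∈ S.Ω, ∃ C : ℝ, ∀ w : List (Fin S.m),
      ‖S.word w x - S.word w y‖ ≤ C * μ ^ w.length := by
    intro x hx y hy
    refine S.hconn.isPreconnected.induction₂ (fun x y => ∃ C : ℝ, ∀ w : List (Fin S.m),
      ‖S.word w x - S.word w y‖ ≤ C * μ ^ w.length) ?_ ?_ ?_ hx hy
    · intro x hx
      obtain ⟨s, hs, C, hC⟩ := hloc x hx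
      exact nhdsWithin_le_nhds (Filter.eventually_of_mem (ball_mem_nhds x hs)
        fun y hy => ⟨C, hC y hy⟩)
    · rintro x y z - - - ⟨C, hC⟩ ⟨D, hD⟩
      refine ⟨C + D, fun w => ?_⟩
      rw [add_mul]
      exact (norm_sub_le_norm_sub_add_norm_sub _ _ _).trans (add_le_add (hC w) (hD w))
    · rintro x y - - ⟨C, hC⟩
      exact ⟨C, fun w => by rw [norm_sub_rev]; exact hC w⟩
  obtain ⟨p, hp⟩ := S.hconn.nonempty
  obtain ⟨C, hC⟩ : ∃ C : ℝ, ∀ x ∈ A, ∀ w : List (Fin S.m),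
      ‖S.word w x - S.word w p‖ ≤ C * μ ^ w.length := by
    refine hAc.induction_on (p := fun s => ∃ C : ℝ, ∀ x ∈ s, ∀ w : List (Fin S.m),
      ‖S.word w x - S.word w p‖ ≤ C * μ ^ w.length) ⟨0, by simp⟩ ?_ ?_ ?_
    · rintro s t hst ⟨C, hC⟩
      exact ⟨C, fun x hx => hC x (hst hx)⟩
    · rintro s t ⟨C, hC⟩ ⟨D, hD⟩
      refine ⟨max C D, fun x hx w => ?_⟩
      rcases hx with hx | hx
      · exact (hC x hx w).trans (by gcongr; exact le_max_left _ _)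
      · exact (hD x hx w).trans (by gcongr; exact le_max_right _ _)
    · intro x hx
      obtain ⟨s, hs, C, hC⟩ := hloc x (hAΩ hx)
      obtain ⟨D, hD⟩ := hpair x (hAΩ hx) p hp
      refine ⟨ball x s, mem_nhdsWithin_of_mem_nhds (ball_mem_nhds x hs), C + D, fun y hy w => ?_⟩
      rw [add_mul]
      refine (norm_sub_le_norm_sub_add_norm_sub _ (S.word w x) _).trans (add_le_add ?_ (hD w))
      rw [norm_sub_rev]; exact hC y hy w
  refine ⟨μ, C + C, h0, h1, fun x hx y hy w => ?_⟩
  rw [add_mul]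
  refine (norm_sub_le_norm_sub_add_norm_sub _ (S.word w p) _).trans (add_le_add (hC x hx w) ?_)
  rw [norm_sub_rev]; exact hC y hy w

theorem IsAttractor.tendsto_norm_deriv_word (hA : S.IsAttractor A) {ε : ℝ} (hε : 0 < ε) :
    ∃ n₀ : ℕ, ∀ w : List (Fin S.m), n₀ ≤ w.length → ∀ x ∈ A, ‖deriv (S.word w) x‖ < ε := by
  obtain ⟨μ, R, h0, h1, hR, h⟩ := exists_norm_deriv_word_le S
  obtain ⟨δ, hδ, hsub⟩ := hA.2.1.exists_cthickening_subset_open S.hopen hA.2.2.1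
  obtain ⟨n₀, hn₀⟩ := exists_pow_lt_of_lt_one (show 0 < ε / (R * δ⁻¹) by positivity) h1
  refine ⟨n₀, fun w hw x hx => ?_⟩
  refine (h w x δ hδ ((closedBall_subset_cthickening hx δ).trans hsub)).trans_lt ?_
  rw [lt_div_iff₀ (by positivity)] at hn₀
  calc R * δ⁻¹ * μ ^ w.length ≤ R * δ⁻¹ * μ ^ n₀ := by
        gcongr R * δ⁻¹ * ?_
        exact pow_le_pow_of_le_one h0.le h1.le hw
    _ < ε := by rwa [mul_comm]

theorem IsAttractor.exists_norm_word_sub_lt (hA : S.IsAttractor A) {ε : ℝ} (hε : 0 < ε) :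
    ∃ n₀ : ℕ, ∀ w : List (Fin S.m), n₀ ≤ w.length → ∀ x ∈ A, ∀ y ∈ A,
      ‖S.word w x - S.word w y‖ < ε := by
  obtain ⟨μ, C, h0, h1, h⟩ := exists_norm_word_sub_le S hA.2.1 hA.2.2.1
  obtain ⟨n₀, hn₀⟩ := exists_pow_lt_of_lt_one (show 0 < ε / (|C| + 1) by positivity) h1
  refine ⟨n₀, fun w hw x hx y hy => (h x hx y hy w).trans_lt ?_⟩
  rw [lt_div_iff₀ (by positivity)] at hn₀
  calc C * μ ^ w.length ≤ (|C| + 1) * μ ^ w.length := by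
        gcongr; linarith [le_abs_self C]
    _ ≤ (|C| + 1) * μ ^ n₀ := by
        gcongr (|C| + 1) * ?_
        exact pow_le_pow_of_le_one h0.le h1.le hw
    _ < ε := by rwa [mul_comm]

/-- The smallest value of `|g_i'|` over all maps of the IFS and all points of the attractor. -/
def minDeriv (S : HolIFS) (A : Set ℂ) : ℝ :=
  sInf {t : ℝ | ∃ j : Fin S.m, ∃ y ∈ A, t = ‖deriv (S.g j) y‖}

theorem minDeriv_le {j : Fin S.m} {y : ℂ} (hy : y ∈ A) : S.minDeriv A ≤ ‖deriv (S.g j) y‖ :=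
  csInf_le ⟨0, by rintro _ ⟨j, y, -, rfl⟩; exact norm_nonneg _⟩ ⟨j, y, hy, rfl⟩

theorem IsAttractor.minDeriv_pos (hA : S.IsAttractor A) : 0 < S.minDeriv A := by
  have hset : {t : ℝ | ∃ j : Fin S.m, ∃ y ∈ A, t = ‖deriv (S.g j) y‖} =
      ⋃ j : Fin S.m, (fun y => ‖deriv (S.g j) y‖) '' A := by
    ext t
    simp only [mem_ofPred_eq, mem_iUnion, mem_image, eq_comm]
  have hc : IsCompact {t : ℝ | ∃ j : Fin S.m, ∃ y ∈ A, t = ‖deriv (S.g j) y‖} := by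
    rw [hset]
    exact isCompact_iUnion fun j => hA.2.1.image_of_continuousOn
      ((((S.hdiff j).deriv S.hopen).continuousOn.mono hA.2.2.1).norm)
  obtain ⟨a, ha⟩ := hA.1
  obtain ⟨j, y, hy, h⟩ := hc.sInf_mem ⟨_, ⟨0, S.hm⟩, a, ha, rfl⟩
  rw [minDeriv, h]
  exact norm_pos_iff.mpr (deriv_word_ne_zero [j] (hA.2.2.1 hy))

theorem IsAttractor.minDeriv_pow_le (hA : S.IsAttractor A) (w : List (Fin S.m)) {y : ℂ}
    (hy : y ∈ A) : S.minDeriv A ^ w.length ≤ ‖deriv (S.word w) y‖ := by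
  induction w with
  | nil => simp [word_nil]
  | cons j w ih =>
    have : deriv (S.word (j :: w)) y = deriv (S.g j) (S.word w y) * deriv (S.word w) y :=
      deriv_word_append [j] w (hA.2.2.1 hy)
    rw [this, norm_mul, List.length_cons, pow_succ']
    exact mul_le_mul (minDeriv_le (hA.mapsTo_word w hy)) ih (pow_nonneg hA.minDeriv_pos.le _)
      (norm_nonneg _)

/-- Every point of the attractor lies in a cylinder of prescribed derivative, up to the
bounded factor `minDeriv`. -/
theorem IsAttractor.exists_word_norm_deriv (hA : S.IsAttractor A) {x : ℂ} (hx : x ∈ A) {t : ℝ}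
    (ht : 0 < t) (hts : t ≤ S.minDeriv A) :
    ∃ v : List (Fin S.m), v ≠ [] ∧ ∃ y ∈ A, S.word v y = x ∧ t ≤ ‖deriv (S.word v) y‖ ∧
      S.minDeriv A * ‖deriv (S.word v) y‖ ≤ t := by
  by_contra! hcon
  have key : ∀ n : ℕ, ∃ v : List (Fin S.m), v.length = n + 1 ∧ ∃ y ∈ A, S.word v y = x ∧
      t ≤ ‖deriv (S.word v) y‖ := by
    intro n
    induction n with
    | zero =>
      obtain ⟨j, y, hy, rfl⟩ := hA.exists_preimage hx
      exact ⟨[j], rfl, y, hy, rfl, hts.trans (minDeriv_le hy)⟩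
    | succ n ih =>
      obtain ⟨v, hv, y, hy, rfl, hd⟩ := ih
      obtain ⟨j, z, hz, rfl⟩ := hA.exists_preimage hy
      have h1 := hcon v (by rintro rfl; simp at hv) _ hy rfl hd
      refine ⟨v ++ [j], by simp [hv], z, hz, by rw [word_append]; rfl, ?_⟩
      rw [deriv_word_append v [j] (hA.2.2.1 hz), norm_mul, mul_comm]
      exact h1.le.trans (mul_le_mul_of_nonneg_right (minDeriv_le hz) (norm_nonneg _))
  obtain ⟨n₀, hn₀⟩ := hA.tendsto_norm_deriv_word ht
  obtain ⟨v, hv, y, hy, -, hd⟩ := key n₀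
  exact (hn₀ v (by lia) y hy).not_ge hd

/-- A cylinder is separated from the rest of the attractor at its own scale. -/
theorem mem_image_word_of_norm_sub_lt {ρ : ℝ} (hρ : 0 < ρ) {p z : ℂ} {v : List (Fin S.m)}
    (hball : ball p ρ ⊆ S.Ω) (hsym : IsSymmetryOn A (ball p ρ) (S.word v)) (hz : z ∈ A)
    (hzp : ‖z - S.word v p‖ < ‖deriv (S.word v) p‖ * ρ / 4) : z ∈ S.word v '' A := by
  obtain ⟨q, hq, rfl⟩ := ball_subset_image_of_injOn hρ ((differentiableOn_word v).mono hball)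
    ((injOn_word v).mono hball) (mem_ball.mpr (by rwa [dist_eq_norm]))
  exact ⟨q, (hsym.2 q hq).mpr hz, rfl⟩

end HolIFS

theorem hasDerivAt_invFunOn {f : ℂ → ℂ} {U : Set ℂ} (hU : IsOpen U) (hf : DifferentiableOn ℂ f U)
    (hinj : InjOn f U) {q : ℂ} (hq : q ∈ U) :
    HasDerivAt (Function.invFunOn f U) (deriv f q)⁻¹ (f q) := by
  have hne := deriv_ne_zero_of_injOn hU hf hinj hq
  have hs : HasStrictDerivAt f (deriv f q) q :=
    (hf.analyticAt (hU.mem_nhds hq)).hasStrictDerivAt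
  have hloc := (hs.to_localInverse hne).hasDerivAt
  refine hloc.congr_of_eventuallyEq ?_
  have hmem : ∀ᶠ w in nhds (f q), hs.localInverse f _ _ hne w ∈ U := by
    have : hs.localInverse f _ _ hne (f q) = q := HasStrictFDerivAt.localInverse_apply_image _
    exact hloc.continuousAt.eventually_mem (by rw [this]; exact hU.mem_nhds hq)
  have hright : ∀ᶠ w in nhds (f q), f (hs.localInverse f _ _ hne w) = w :=
    HasStrictFDerivAt.eventually_right_inverse _
  filter_upwards [hmem, hright] with w h1 h2
  have hex : ∃ x ∈ U, f x = w := ⟨_, h1, h2⟩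
  exact hinj (Function.invFunOn_mem hex) h1 ((Function.invFunOn_eq hex).trans h2.symm)

theorem norm_deriv_le_of_norm_le_ball {f : ℂ → ℂ} {a x : ℂ} {R M : ℝ}
    (hf : DifferentiableOn ℂ f (ball a R)) (hM : ∀ z ∈ ball a R, ‖f z‖ ≤ M)
    (hx : x ∈ ball a (R / 2)) : ‖deriv f x‖ ≤ 2 * M / R := by
  have hR : 0 < R := by linarith [dist_nonneg.trans_lt (mem_ball.mp hx)]
  have hsub : closedBall x (R / 2) ⊆ ball a R :=
    closedBall_subset_ball' (by linarith [mem_ball.mp hx])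
  refine (Complex.norm_deriv_le_of_forall_mem_sphere_norm_le (by positivity)
    ((hf.mono hsub).diffContOnCl_ball Subset.rfl)
    fun z hz => hM z (hsub (sphere_subset_closedBall hz))).trans_eq ?_
  field_simp

theorem norm_sub_le_of_norm_le_ball {f : ℂ → ℂ} {a x y : ℂ} {R M : ℝ}
    (hf : DifferentiableOn ℂ f (ball a R)) (hM : ∀ z ∈ ball a R, ‖f z‖ ≤ M)
    (hx : x ∈ ball a (R / 2)) (hy : y ∈ ball a (R / 2)) :
    ‖f y - f x‖ ≤ 2 * M / R * ‖y - x‖ := by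
  have hR : 0 < R := by linarith [dist_nonneg.trans_lt (mem_ball.mp hx)]
  exact (convex_ball a (R / 2)).norm_image_sub_le_of_norm_deriv_le
    (fun z hz => hf.differentiableAt (isOpen_ball.mem_nhds (ball_subset_ball (by linarith) hz)))
    (fun z hz => norm_deriv_le_of_norm_le_ball hf hM hz) hx hy

/-- The radius at which the growth function `s / (1 - s) ^ 2` equals `1 / 4`. -/
def koebeRadius : ℝ := 3 - Real.sqrt 8

theorem koebeRadius_sq : koebeRadius ^ 2 = 6 * koebeRadius - 1 := by
  have := Real.sq_sqrt (show (0 : ℝ) ≤ 8 by norm_num)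
  rw [koebeRadius]
  linear_combination this

theorem koebeRadius_gt : 4 / 25 < koebeRadius := by
  have : Real.sqrt 8 < 2.84 := by rw [Real.sqrt_lt' (by norm_num)]; norm_num
  rw [koebeRadius]; linarith

theorem koebeRadius_lt : koebeRadius < 1 / 5 := by
  have : 2.8 < Real.sqrt 8 := by rw [Real.lt_sqrt (by norm_num)]; norm_num
  rw [koebeRadius]; linarith

theorem koebeRadius_pos : 0 < koebeRadius := by linarith [koebeRadius_gt]

/-- On the disc of radius `koebeRadius * R`, a univalent function on the disc of radius `R` stays
inside the disc provided by the Koebe one-quarter theorem. -/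
theorem norm_sub_lt_of_mem_ball_koebeRadius {f : ℂ → ℂ} {a z : ℂ} {R : ℝ} (hR : 0 < R)
    (hf : DifferentiableOn ℂ f (ball a R)) (hinj : InjOn f (ball a R))
    (hz : z ∈ ball a (koebeRadius * R)) : ‖f z - f a‖ < ‖deriv f a‖ * R / 4 := by
  have hd := norm_pos_iff.mpr (deriv_ne_zero_of_injOn isOpen_ball hf hinj (mem_ball_self hR))
  rw [mem_ball, dist_eq_norm] at hz
  set s := ‖z - a‖ / R with hs
  have hsR : ‖z - a‖ = s * R := by rw [hs]; field_simp
  have hs0 : 0 ≤ s := by positivity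
  have hst : s < koebeRadius := by rwa [hs, div_lt_iff₀ hR]
  have hs1 : s < 1 := by linarith [koebeRadius_lt]
  refine (norm_sub_le_of_injOn hR hf hinj hs0 hs1 hsR).trans_lt ?_
  rw [mul_div_assoc, mul_assoc]
  have h1 : 0 < 1 - s := by linarith
  have : s / (1 - s) ^ 2 < 1 / 4 := by
    rw [div_lt_div_iff₀ (by positivity) (by norm_num)]
    nlinarith [koebeRadius_sq, koebeRadius_lt]
  calc ‖deriv f a‖ * (R * (s / (1 - s) ^ 2)) < ‖deriv f a‖ * (R * (1 / 4)) := by gcongr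
    _ = _ := by ring

/-- The branch of `f⁻¹ ∘ g` determined by `f y = g a`. -/
theorem exists_inverse_branch_comp {f g : ℂ → ℂ} {a y : ℂ} {ρ : ℝ} (hρ : 0 < ρ)
    (hg : DifferentiableOn ℂ g (ball a ρ)) (hginj : InjOn g (ball a ρ))
    (hf : DifferentiableOn ℂ f (ball y ρ)) (hfinj : InjOn f (ball y ρ)) (hfg : f y = g a)
    (hd : ‖deriv g a‖ ≤ ‖deriv f y‖) :
    ∃ H : ℂ → ℂ, H a = y ∧ DifferentiableOn ℂ H (ball a (koebeRadius * ρ)) ∧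
      InjOn H (ball a (koebeRadius * ρ)) ∧ MapsTo H (ball a (koebeRadius * ρ)) (ball y ρ) ∧
      (∀ x ∈ ball a (koebeRadius * ρ), f (H x) = g x) ∧ deriv H a * deriv f y = deriv g a := by
  have hsub : ball a (koebeRadius * ρ) ⊆ ball a ρ :=
    ball_subset_ball (by nlinarith [koebeRadius_lt])
  have hya : y ∈ ball y ρ := mem_ball_self hρ
  have haa : a ∈ ball a (koebeRadius * ρ) := mem_ball_self (mul_pos koebeRadius_pos hρ)
  have hex : ∀ x ∈ ball a (koebeRadius * ρ), ∃ q ∈ ball y ρ, f q = g x := fun x hx => by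
    refine ball_subset_image_of_injOn hρ hf hfinj ?_
    rw [mem_ball, dist_eq_norm, hfg]
    refine (norm_sub_lt_of_mem_ball_koebeRadius hρ hg hginj hx).trans_le ?_
    gcongr
  have hmaps : MapsTo (Function.invFunOn f (ball y ρ) ∘ g) (ball a (koebeRadius * ρ)) (ball y ρ) :=
    fun x hx => Function.invFunOn_mem (hex x hx)
  have hfH : ∀ x ∈ ball a (koebeRadius * ρ), f (Function.invFunOn f (ball y ρ) (g x)) = g x :=
    fun x hx => Function.invFunOn_eq (hex x hx)
  have hHa : Function.invFunOn f (ball y ρ) (g a) = y :=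
    hfinj (hmaps haa) hya ((hfH a haa).trans hfg.symm)
  have hgd : ∀ x ∈ ball a (koebeRadius * ρ), HasDerivAt g (deriv g x) x := fun x hx =>
    hg.hasDerivAt (isOpen_ball.mem_nhds (hsub hx))
  have hHd : ∀ x ∈ ball a (koebeRadius * ρ), HasDerivAt (Function.invFunOn f (ball y ρ) ∘ g)
      ((deriv f (Function.invFunOn f (ball y ρ) (g x)))⁻¹ * deriv g x) x := fun x hx => by
    refine HasDerivAt.comp x ?_ (hgd x hx)
    have := hasDerivAt_invFunOn isOpen_ball hf hfinj (hmaps hx)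
    rwa [Function.comp_apply, hfH x hx] at this
  refine ⟨Function.invFunOn f (ball y ρ) ∘ g, hHa,
    fun x hx => (hHd x hx).differentiableAt.differentiableWithinAt, fun x hx x' hx' h => ?_,
    hmaps, hfH, ?_⟩
  · refine hginj (hsub hx) (hsub hx') ?_
    rw [← hfH x hx, ← hfH x' hx']
    exact congrArg f h
  · have := deriv_ne_zero_of_injOn isOpen_ball hf hfinj hya
    rw [(hHd a haa).deriv, hHa]
    field_simp

namespace HolIFS

variable {S : HolIFS} {A : Set ℂ}

/-- Every point of the attractor lies, at every small scale, in a piece of the attractor of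
comparable size which is relatively isolated at that scale. -/
theorem IsAttractor.exists_isolated_piece (hA : S.IsAttractor A) {ρ : ℝ} (hρ : 0 < ρ)
    (hball : ∀ a ∈ A, ball a ρ ⊆ S.Ω)
    (hsym : ∀ a ∈ A, ∀ v : List (Fin S.m), v ≠ [] → IsSymmetryOn A (ball a ρ) (S.word v)) :
    ∃ κ : ℝ, 0 < κ ∧ ∀ x ∈ A, ∀ t : ℝ, 0 < t → t ≤ S.minDeriv A →
      ∃ (P : Set ℂ) (l : ℝ), IsCompact P ∧ x ∈ P ∧ P ⊆ A ∧ t ≤ l ∧ S.minDeriv A * l ≤ t ∧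
        P ⊆ ball x (l * ρ / 4) ∧ ∀ z ∈ P, ∀ z' ∈ A, ‖z' - z‖ < κ * l → z' ∈ P := by
  have hθ := koebeRadius_pos
  have hσ := hA.minDeriv_pos
  obtain ⟨n₀, hn₀⟩ := hA.exists_norm_word_sub_lt (show 0 < koebeRadius * ρ / 2 by positivity)
  refine ⟨koebeRadius * S.minDeriv A ^ n₀ * ρ / 2, by positivity, fun x hx t ht hts => ?_⟩
  obtain ⟨u, hu, y, hy, rfl, htl, hlt⟩ := hA.exists_word_norm_deriv hx ht hts
  obtain ⟨w, hw, y', hy', rfl⟩ := hA.exists_word_preimage hy n₀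
  refine ⟨S.word (u ++ w) '' A, ‖deriv (S.word u) (S.word w y')‖,
    hA.2.1.image_of_continuousOn ((differentiableOn_word _).continuousOn.mono hA.2.2.1),
    ⟨y', hy', by rw [word_append]; rfl⟩, (hA.mapsTo_word _).image_subset, htl, hlt, ?_, ?_⟩
  · rintro _ ⟨q, hq, rfl⟩
    rw [word_append, mem_ball, dist_eq_norm]
    refine norm_sub_lt_of_mem_ball_koebeRadius hρ ((differentiableOn_word u).mono (hball _ hy))
      ((injOn_word u).mono (hball _ hy)) (mem_ball.mpr ?_)
    rw [dist_eq_norm]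
    exact (hn₀ w hw.ge q hq y' hy').trans_le (by nlinarith [mul_pos hθ hρ])
  · rintro _ ⟨p, hp, rfl⟩ z' hz' hlt
    refine mem_image_word_of_norm_sub_lt hρ (hball p hp)
      (hsym p hp _ (by simp [hu])) hz' (hlt.trans_le ?_)
    have hq := hA.mapsTo_word w hp
    have hcauchy := norm_deriv_le_of_norm_le_ball (f := fun z => S.word u z - S.word u (S.word w p))
      (a := S.word w p) (x := S.word w y') (R := koebeRadius * ρ)
      (M := ‖deriv (S.word u) (S.word w p)‖ * ρ / 4)
      (((differentiableOn_word u).mono ((ball_subset_ball (by nlinarith [koebeRadius_lt])).trans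
        (hball _ hq))).sub_const _)
      (fun z hz => (norm_sub_lt_of_mem_ball_koebeRadius hρ
        ((differentiableOn_word u).mono (hball _ hq))
        ((injOn_word u).mono (hball _ hq)) hz).le)
      (by rw [mem_ball, dist_eq_norm]; exact hn₀ w hw.ge y' hy' p hp)
    rw [deriv_sub_const_fun, le_div_iff₀ (by positivity)] at hcauchy
    have hpow := hA.minDeriv_pow_le w hp
    rw [hw] at hpow
    rw [deriv_word_append u w (hA.2.2.1 hp), norm_mul]
    have := mul_le_mul hcauchy hpow (by positivity) (by positivity)
    linarith

theorem IsAttractor.accPt (hA : S.IsAttractor A) (hA2 : A.Nontrivial) {a : ℂ} (ha : a ∈ A) :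
    AccPt a (Filter.principal A) := by
  rw [accPt_iff_nhds]
  intro U hU
  obtain ⟨ε, hε, hεU⟩ := Metric.mem_nhds_iff.mp hU
  obtain ⟨n₀, hn₀⟩ := hA.exists_norm_word_sub_lt hε
  obtain ⟨w, hw, y, hy, rfl⟩ := hA.exists_word_preimage ha n₀
  obtain ⟨y', hy', hne⟩ := hA2.exists_ne y
  refine ⟨S.word w y', ⟨hεU ?_, hA.mapsTo_word w hy'⟩,
    fun h => hne (injOn_word w (hA.2.2.1 hy') (hA.2.2.1 hy) h)⟩
  rw [mem_ball, dist_eq_norm]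
  exact hn₀ w hw.ge y' hy' y hy

end HolIFS

/-- Univalent symmetries of `A` on `ball a r` with uniform bounds. -/
structure IsBoundedSymmetry (A : Set ℂ) (a : ℂ) (r c M : ℝ) (H : ℂ → ℂ) : Prop where
  differentiableOn : DifferentiableOn ℂ H (ball a r)
  injOn : InjOn H (ball a r)
  mem_iff : ∀ x ∈ ball a r, (x ∈ A ↔ H x ∈ A)
  le_norm_deriv : c ≤ ‖deriv H a‖
  norm_le : ∀ x ∈ ball a r, ‖H x‖ ≤ M

theorem IsBoundedSymmetry.half_le_norm_deriv {A : Set ℂ} {a x : ℂ} {r r₁ c M : ℝ} {H : ℂ → ℂ}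
    (hH : IsBoundedSymmetry A a r c M H) (hM : 0 < M) (hr₁ : r₁ ≤ r / 4)
    (hr₁' : r₁ ≤ c * r ^ 2 / (16 * M)) (hx : x ∈ ball a r₁) : c / 2 ≤ ‖deriv H x‖ := by
  have hx0 : 0 < r₁ := dist_nonneg.trans_lt (mem_ball.mp hx)
  have hr : 0 < r := by linarith
  have hlip := norm_sub_le_of_norm_le_ball (f := deriv H) (a := a) (x := a) (y := x) (R := r / 2)
    ((hH.differentiableOn.deriv isOpen_ball).mono (ball_subset_ball (by linarith)))
    (fun z hz => norm_deriv_le_of_norm_le_ball hH.differentiableOn hH.norm_le hz)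
    (mem_ball_self (by positivity)) (ball_subset_ball (by linarith) hx)
  rw [mem_ball, dist_eq_norm] at hx
  have h1 : 2 * (2 * M / r) / (r / 2) * ‖x - a‖ ≤ c / 2 := by
    calc 2 * (2 * M / r) / (r / 2) * ‖x - a‖
        ≤ 2 * (2 * M / r) / (r / 2) * (c * r ^ 2 / (16 * M)) := by gcongr; linarith
      _ = c / 2 := by field_simp; ring
  have h2 := norm_sub_norm_le (deriv H a) (deriv H x)
  rw [norm_sub_rev] at h2
  linarith [hH.le_norm_deriv]

/-- Two bounded symmetries of the attractor which are close to each other coincide. -/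
theorem HolIFS.IsAttractor.exists_eqOn_of_norm_sub_le {S : HolIFS} {A : Set ℂ}
    (hA : S.IsAttractor A) (hA2 : A.Nontrivial) {ρ : ℝ} (hρ : 0 < ρ)
    (hball : ∀ a ∈ A, ball a ρ ⊆ S.Ω)
    (hsym : ∀ a ∈ A, ∀ v : List (Fin S.m), v ≠ [] → IsSymmetryOn A (ball a ρ) (S.word v))
    {r c M : ℝ} (hr : 0 < r) (hc : 0 < c) (hM : 0 < M) :
    ∃ η : ℝ, 0 < η ∧ ∀ a ∈ A, ∀ H₁ H₂ : ℂ → ℂ, IsBoundedSymmetry A a r c M H₁ →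
      IsBoundedSymmetry A a r c M H₂ → (∀ z ∈ ball a (r / 2), ‖H₁ z - H₂ z‖ ≤ η) →
      EqOn H₁ H₂ (ball a r) := by
  obtain ⟨κ, hκ, hpiece⟩ := hA.exists_isolated_piece hρ hball hsym
  have hσ := hA.minDeriv_pos
  set σ := S.minDeriv A
  obtain ⟨r₀, hr₀, hr₀r, hr₀c⟩ : ∃ r₀ : ℝ, 0 < r₀ ∧ 2 * r₀ ≤ r / 4 ∧
      2 * r₀ ≤ c * r ^ 2 / (16 * M) :=
    ⟨min (r / 4) (c * r ^ 2 / (16 * M)) / 2, by positivity,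
      by linarith [min_le_left (r / 4) (c * r ^ 2 / (16 * M))],
      by linarith [min_le_right (r / 4) (c * r ^ 2 / (16 * M))]⟩
  obtain ⟨e, he, he1, heρ, heκ⟩ : ∃ e : ℝ, 0 < e ∧ e ≤ 1 ∧ e ≤ r₀ / ρ ∧ e ≤ r₀ / κ :=
    ⟨min 1 (min (r₀ / ρ) (r₀ / κ)), by positivity, min_le_left _ _,
      (min_le_right _ _).trans (min_le_left _ _), (min_le_right _ _).trans (min_le_right _ _)⟩
  rw [le_div_iff₀ (by positivity)] at heρ heκ
  refine ⟨σ * e * (c * κ) / 13, by positivity, fun a ha H₁ H₂ h₁ h₂ hclose => ?_⟩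
  set η := σ * e * (c * κ) / 13 with hη
  have hη0 : 0 < η := by positivity
  have hzero : ∀ x ∈ A ∩ ball a r₀, H₁ x = H₂ x := by
    rintro x ⟨hxA, hxa⟩
    by_contra hne
    set τ := H₁ x - H₂ x with hτ
    have hd : 0 < ‖τ‖ := norm_pos_iff.mpr (sub_ne_zero.mpr hne)
    have hdη : ‖τ‖ ≤ η := hclose x (ball_subset_ball (by linarith) hxa)
    have hts : 13 / (c * κ) * ‖τ‖ ≤ σ * e := by
      calc 13 / (c * κ) * ‖τ‖ ≤ 13 / (c * κ) * η := by gcongr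
        _ = σ * e := by rw [hη]; field_simp
    obtain ⟨P, l, hPc, hxP, hPA, htl, hlt, hPball, hiso⟩ := hpiece x hxA (13 / (c * κ) * ‖τ‖)
      (by positivity) (hts.trans (by nlinarith))
    have hle : l ≤ e := le_of_mul_le_mul_left (hlt.trans hts) hσ
    have hl : 0 < l := (by positivity : 0 < 13 / (c * κ) * ‖τ‖).trans_le htl
    have hlη : l * η ≤ e * ‖τ‖ := by
      have : σ * l * η ≤ 13 / (c * κ) * ‖τ‖ * η := by gcongr
      have h2 : 13 / (c * κ) * ‖τ‖ * η = σ * (e * ‖τ‖) := by rw [hη]; field_simp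
      exact le_of_mul_le_mul_left (by linarith) hσ
    have hlρ : l * ρ ≤ r₀ := (mul_le_mul_of_nonneg_right hle hρ.le).trans heρ
    have hlκ : κ * l ≤ r₀ := by nlinarith
    have hPa : ∀ z ∈ P, z ∈ ball a (2 * r₀) := fun z hz => by
      have h1 := mem_ball.mp (hPball hz)
      have h2 := mem_ball.mp hxa
      exact mem_ball.mpr ((dist_triangle z x a).trans_lt (by linarith))
    have hDP : ∀ z ∈ P, ‖(H₁ z - H₂ z) - τ‖ ≤ ‖τ‖ / 2 := fun z hz => by
      have hlip := norm_sub_le_of_norm_le_ball (f := fun z => H₁ z - H₂ z) (a := a) (x := x)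
        (y := z) (R := r / 2) (M := η)
        ((h₁.differentiableOn.sub h₂.differentiableOn).mono (ball_subset_ball (by linarith)))
        hclose (ball_subset_ball (by linarith) hxa) (ball_subset_ball (by linarith) (hPa z hz))
      have hzx := (mem_ball.mp (hPball hz)).le
      rw [dist_eq_norm] at hzx
      calc ‖(H₁ z - H₂ z) - τ‖ ≤ 2 * η / (r / 2) * (l * ρ / 4) := hlip.trans (by gcongr)
        _ = (l * η) * ρ / r := by field_simp; ring
        _ ≤ (e * ‖τ‖) * ρ / r := by gcongr
        _ = ‖τ‖ * (e * ρ) / r := by ring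
        _ ≤ ‖τ‖ * (r / 2) / r := by gcongr; linarith
        _ = ‖τ‖ / 2 := by field_simp
    obtain ⟨p, hpP, hmax⟩ := hPc.exists_isMaxOn ⟨x, hxP⟩ (f := fun z => inner ℝ τ (H₂ z))
      (continuousOn_const.inner (h₂.differentiableOn.continuousOn.mono
        fun z hz => ball_subset_ball (by linarith) (hPa z hz)))
    have hpr : ball p r₀ ⊆ ball a r := ball_subset_ball' (by linarith [mem_ball.mp (hPa p hpP)])
    have hpr' : ball p (κ * l) ⊆ ball a r := (ball_subset_ball hlκ).trans hpr
    have hDp := hDP p hpP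
    have hDp' : ‖H₁ p - H₂ p‖ ≤ 3 / 2 * ‖τ‖ := by
      have := norm_le_norm_sub_add (H₁ p - H₂ p) τ
      linarith
    have hmem : H₁ p ∈ H₂ '' ball p (κ * l) := by
      refine ball_subset_image_of_injOn (by positivity) (h₂.differentiableOn.mono hpr')
        (h₂.injOn.mono hpr') ?_
      rw [mem_ball, dist_eq_norm]
      have hder := h₂.half_le_norm_deriv hM hr₀r hr₀c (hPa p hpP)
      rw [div_mul_eq_mul_div, div_le_iff₀ (by positivity)] at htl
      have := mul_le_mul_of_nonneg_right hder (by positivity : 0 ≤ κ * l)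
      linarith
    obtain ⟨z', hz', hz'eq⟩ := hmem
    have hpa : p ∈ ball a r := hpr (mem_ball_self hr₀)
    have hz'P : z' ∈ P := by
      refine hiso p hpP z' ((h₂.mem_iff z' (hpr' hz')).mpr ?_)
        (by rwa [mem_ball, dist_eq_norm] at hz')
      rw [hz'eq]
      exact (h₁.mem_iff p hpa).mp (hPA hpP)
    have hle2 : inner ℝ τ (H₂ z') ≤ inner ℝ τ (H₂ p) := hmax hz'P
    rw [hz'eq, ← sub_nonpos, ← inner_sub_right,
      ← add_sub_cancel τ (H₁ p - H₂ p), inner_add_right, real_inner_self_eq_norm_sq] at hle2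
    have h3 := neg_le_of_abs_le (abs_real_inner_le_norm τ (H₁ p - H₂ p - τ))
    nlinarith [mul_le_mul_of_nonneg_left hDp hd.le]
  refine AnalyticOnNhd.eqOn_of_preconnected_of_frequently_eq
    (h₁.differentiableOn.analyticOnNhd isOpen_ball)
    (h₂.differentiableOn.analyticOnNhd isOpen_ball) (convex_ball a r).isPreconnected
    (mem_ball_self hr) ?_
  have hacc := (accPt_iff_frequently.mp (hA.accPt hA2 ha)).and_eventually
    (ball_mem_nhds a hr₀)
  rw [frequently_nhdsWithin_iff]
  exact hacc.mono fun y hy => ⟨hzero y ⟨hy.1.2, hy.2⟩, hy.1.1⟩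

/-- A family of bounded holomorphic functions on a disc in which nearby members coincide is
finite, with a bound on its cardinality that does not depend on the centre. -/
theorem exists_ncard_domRestrict_le {r M η : ℝ} (hr : 0 < r) (hM : 0 < M) (hη : 0 < η) :
    ∃ K : ℕ, ∀ (a : ℂ) (𝓗 : Set (ℂ → ℂ)), (∀ H ∈ 𝓗, DifferentiableOn ℂ H (ball a r)) →
      (∀ H ∈ 𝓗, ∀ z ∈ ball a r, ‖H z‖ ≤ M) →
      (∀ H₁ ∈ 𝓗, ∀ H₂ ∈ 𝓗, (∀ z ∈ ball a (r / 2), ‖H₁ z - H₂ z‖ ≤ η) → EqOn H₁ H₂ (ball a r)) →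
      ((ball a r).domRestrict '' 𝓗).Finite ∧ ((ball a r).domRestrict '' 𝓗).ncard ≤ K := by
  obtain ⟨T, hTs, hTf, hT⟩ := finite_approx_of_totallyBounded
    ((isCompact_closedBall (0 : ℂ) (r / 2)).totallyBounded.subset ball_subset_closedBall)
    (η * r / (8 * M)) (by positivity)
  obtain ⟨C, -, hCf, hC⟩ := finite_approx_of_totallyBounded
    (isCompact_closedBall (0 : ℂ) M).totallyBounded (η / 4) (by positivity)
  have := hTf.to_subtype
  have := hCf.to_subtype
  refine ⟨Nat.card (T → C), fun a 𝓗 hd hb hrig => ?_⟩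
  have hTa : ∀ p : T, a + p ∈ ball a (r / 2) := fun p => by simpa using hTs p.2
  have hcode : ∀ h : (ball a r).domRestrict '' 𝓗, ∃ (H : ℂ → ℂ) (k : T → C), H ∈ 𝓗 ∧
      (ball a r).domRestrict H = h ∧ ∀ p : T, ‖H (a + p) - k p‖ < η / 4 := by
    rintro ⟨_, H, hH, rfl⟩
    have hk : ∀ p : T, ∃ c : C, ‖H (a + p) - c‖ < η / 4 := fun p => by
      have h1 : H (a + p) ∈ closedBall 0 M := mem_closedBall_zero_iff.mpr
        (hb H hH _ (ball_subset_ball (by linarith) (hTa p)))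
      obtain ⟨c, hc, h2⟩ := mem_iUnion₂.mp (hC h1)
      exact ⟨⟨c, hc⟩, by rwa [mem_ball, dist_eq_norm] at h2⟩
    choose k hk using hk
    exact ⟨H, k, hH, rfl, hk⟩
  choose H k hH hHh hk using hcode
  have hinj : Function.Injective k := fun h₁ h₂ heq => by
    rw [← Subtype.coe_inj, ← hHh h₁, ← hHh h₂, domRestrict_eq_domRestrict_iff]
    refine hrig _ (hH h₁) _ (hH h₂) fun z hz => ?_
    have hz0 : z - a ∈ ball 0 (r / 2) := by
      rwa [mem_ball_zero_iff, ← dist_eq_norm, ← mem_ball]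
    obtain ⟨p, hp, hzp⟩ := mem_iUnion₂.mp (hT hz0)
    have hpz : ‖z - (a + p)‖ < η * r / (8 * M) := by
      rwa [← sub_sub, ← dist_eq_norm, ← mem_ball]
    have hlip : ∀ h, ‖H h z - H h (a + p)‖ ≤ η / 4 := fun h => by
      calc ‖H h z - H h (a + p)‖ ≤ 2 * M / r * ‖z - (a + p)‖ :=
            norm_sub_le_of_norm_le_ball (hd _ (hH h)) (hb _ (hH h)) (hTa ⟨p, hp⟩) hz
        _ ≤ 2 * M / r * (η * r / (8 * M)) := by gcongr
        _ = η / 4 := by field_simp; norm_num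
    have h1 := hk h₁ ⟨p, hp⟩
    have h2 := hk h₂ ⟨p, hp⟩
    rw [← heq, norm_sub_rev] at h2
    have e : H h₁ z - H h₂ z = (H h₁ z - H h₁ (a + p)) + (H h₁ (a + p) - k h₁ ⟨p, hp⟩) +
        (k h₁ ⟨p, hp⟩ - H h₂ (a + p)) - (H h₂ z - H h₂ (a + p)) := by ring
    rw [e]
    refine (norm_sub_le _ _).trans ?_
    linarith [norm_add₃_le (a := H h₁ z - H h₁ (a + p)) (b := H h₁ (a + p) - k h₁ ⟨p, hp⟩)
      (c := k h₁ ⟨p, hp⟩ - H h₂ (a + p)), hlip h₁, hlip h₂]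
  exact ⟨finite_coe_iff.mp (Finite.of_injective k hinj), Nat.card_le_card_of_injective k hinj⟩

/-- For every point `a` and every word `w` of the first IFS whose derivative is small enough there
is a word `v` of the second one for which `f_v⁻¹ ∘ g_w` has a branch on a definite disc. -/
theorem HolIFS.IsAttractor.exists_inverse_branch_symmetry {G F : HolIFS} {A : Set ℂ}
    (hAg : G.IsAttractor A) (hAf : F.IsAttractor A) {ρ M : ℝ} (hρ : 0 < ρ)
    (hballG : ∀ a ∈ A, ball a ρ ⊆ G.Ω) (hballF : ∀ a ∈ A, ball a ρ ⊆ F.Ω)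
    (hsymG : ∀ a ∈ A, ∀ w : List (Fin G.m), w ≠ [] → IsSymmetryOn A (ball a ρ) (G.word w))
    (hsymF : ∀ a ∈ A, ∀ v : List (Fin F.m), v ≠ [] → IsSymmetryOn A (ball a ρ) (F.word v))
    (hM : ∀ a ∈ A, ∀ z ∈ ball a ρ, ‖z‖ ≤ M) {a : ℂ} (ha : a ∈ A) {w : List (Fin G.m)}
    (hw : ‖deriv (G.word w) a‖ ≤ F.minDeriv A) :
    ∃ (v : List (Fin F.m)) (H : ℂ → ℂ), v ≠ [] ∧
      F.minDeriv A ^ (v.length + 1) ≤ ‖deriv (G.word w) a‖ ∧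
      IsBoundedSymmetry A a (koebeRadius * ρ) (F.minDeriv A) M H ∧
      (∀ x ∈ ball a (koebeRadius * ρ), F.word v (H x) = G.word w x) ∧
      MapsTo H (ball a (koebeRadius * ρ)) (ball (H a) ρ) := by
  have hpos : 0 < ‖deriv (G.word w) a‖ :=
    norm_pos_iff.mpr (deriv_word_ne_zero w (hAg.2.2.1 ha))
  obtain ⟨v, hv, y, hy, hvy, htl, hlt⟩ :=
    hAf.exists_word_norm_deriv (hAg.mapsTo_word w ha) hpos hw
  obtain ⟨H, hHa, hHd, hHi, hHm, hFH, hder⟩ := exists_inverse_branch_comp hρ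
    ((differentiableOn_word w).mono (hballG a ha)) ((injOn_word w).mono (hballG a ha))
    ((differentiableOn_word v).mono (hballF y hy)) ((injOn_word v).mono (hballF y hy)) hvy htl
  refine ⟨v, H, hv, ?_, ⟨hHd, hHi, fun x hx => ?_, ?_, fun x hx => hM y hy _ (hHm hx)⟩, hFH,
    by rwa [hHa]⟩
  · rw [pow_succ']
    exact (mul_le_mul_of_nonneg_left (hAf.minDeriv_pow_le v hy) hAf.minDeriv_pos.le).trans hlt
  · have hGx : x ∈ A ↔ G.word w x ∈ A := by
      rcases eq_or_ne w [] with rfl | hne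
      · rfl
      · exact (hsymG a ha w hne).2 x (ball_subset_ball (by nlinarith [koebeRadius_lt]) hx)
    rw [hGx, ← hFH x hx, ← (hsymF y hy v hv).2 _ (hHm hx)]
  · rw [← hder, norm_mul] at hlt
    exact le_of_mul_le_mul_right hlt (hpos.trans_le htl)

/-- Key Lemma: let `G`, `F` be holomorphic IFS with the SSC sharing the attractor `A`,
`ρ > 0` such that `B(a, ρ) ⊆ Ω_G ∩ Ω_F` and all compositions `g_w`, `f_v` are symmetries
of `A` on all balls `B(a, ρ)`, `a ∈ A`; let `s_F = inf {|f_j'(y)| : j, y ∈ A}` and `N`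
with `|g_w'| ≤ s_F` on `A` for `|w| ≥ N`, and `r = (3 − √8) ρ`. Then there is a word
function `v(a, w)` (and corresponding maps `H_{w, v(a,w)} = f_{v(a,w)}⁻¹ ∘ g_w`) with:
`|v(a, w)| → ∞` as `|w| → ∞` uniformly; each `H_{w, v(a,w)}` is defined and univalent on
`B(a, r)` with `B(H(a), (s_F/25) ρ) ⊆ H(B(a, r)) ⊆ B(H(a), ρ)`; each `H_{w, v(a,w)}` is a
symmetry of `A` on `B(a, r)`; and there is `K = K(F, G) < ∞` bounding, for every `a ∈ A`,
the number of different functions `H_{w, v(a,w)}` on `B(a, r)` over all `|w| ≥ N`. -/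
theorem stmt_15 (G F : HolIFS) (A : Set ℂ)
    (hAg : G.IsAttractor A) (hAf : F.IsAttractor A) (hA2 : A.Nontrivial)
    (hSSCg : G.SSC A) (hSSCf : F.SSC A)
    (ρ : ℝ) (hρ : 0 < ρ)
    (hρΩ : ∀ a ∈ A, Metric.ball a ρ ⊆ G.Ω ∩ F.Ω)
    (hsymG : ∀ a ∈ A, ∀ w : List (Fin G.m), w ≠ [] →
      IsSymmetryOn A (Metric.ball a ρ) (G.word w))
    (hsymF : ∀ a ∈ A, ∀ v : List (Fin F.m), v ≠ [] →
      IsSymmetryOn A (Metric.ball a ρ) (F.word v))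
    (sF : ℝ)
    (hsF : sF = sInf {t : ℝ | ∃ j : Fin F.m, ∃ y ∈ A, t = ‖deriv (F.g j) y‖})
    (N : ℕ)
    (hN : ∀ w : List (Fin G.m), N ≤ w.length → ∀ x ∈ A,
      ‖deriv (G.word w) x‖ ≤ sF)
    (r : ℝ) (hr : r = (3 - Real.sqrt 8) * ρ) :
    ∃ (v : ℂ → List (Fin G.m) → List (Fin F.m))
      (H : ℂ → List (Fin G.m) → ℂ → ℂ) (K : ℕ),
      (∀ C : ℕ, ∃ n₀ : ℕ, ∀ a ∈ A, ∀ w : List (Fin G.m),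
        N ≤ w.length → n₀ ≤ w.length → C ≤ (v a w).length) ∧
      (∀ a ∈ A, ∀ w : List (Fin G.m), N ≤ w.length →
        v a w ≠ [] ∧
        DifferentiableOn ℂ (H a w) (Metric.ball a r) ∧
        Set.InjOn (H a w) (Metric.ball a r) ∧
        (∀ x ∈ Metric.ball a r, F.word (v a w) (H a w x) = G.word w x) ∧
        Metric.ball (H a w a) (sF / 25 * ρ) ⊆ H a w '' Metric.ball a r ∧
        H a w '' Metric.ball a r ⊆ Metric.ball (H a w a) ρ ∧
        IsSymmetryOn A (Metric.ball a r) (H a w)) ∧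
      (∀ a ∈ A,
        Set.Finite ((Metric.ball a r).restrict ''
          {h : ℂ → ℂ | ∃ w : List (Fin G.m), N ≤ w.length ∧ h = H a w}) ∧
        ((Metric.ball a r).restrict ''
          {h : ℂ → ℂ | ∃ w : List (Fin G.m), N ≤ w.length ∧ h = H a w}).ncard ≤ K) := by
  obtain ⟨R, hR, hAR⟩ := hAg.2.1.isBounded.exists_pos_norm_le
  have hballG : ∀ a ∈ A, ball a ρ ⊆ G.Ω := fun a ha => (hρΩ a ha).trans inter_subset_left
  have hballF : ∀ a ∈ A, ball a ρ ⊆ F.Ω := fun a ha => (hρΩ a ha).trans inter_subset_right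
  have hM : ∀ a ∈ A, ∀ z ∈ ball a ρ, ‖z‖ ≤ R + ρ := fun a ha z hz => by
    rw [mem_ball, dist_eq_norm] at hz
    linarith [norm_le_norm_add_norm_sub' z a, hAR a ha]
  change sF = F.minDeriv A at hsF
  change r = koebeRadius * ρ at hr
  have hs : 0 < sF := hsF ▸ hAf.minDeriv_pos
  have hr0 : 0 < r := hr ▸ mul_pos koebeRadius_pos hρ
  have key : ∀ (a : ℂ) (w : List (Fin G.m)), ∃ (v : List (Fin F.m)) (H : ℂ → ℂ),
      a ∈ A → N ≤ w.length → v ≠ [] ∧ sF ^ (v.length + 1) ≤ ‖deriv (G.word w) a‖ ∧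
        IsBoundedSymmetry A a r sF (R + ρ) H ∧
        (∀ x ∈ ball a r, F.word v (H x) = G.word w x) ∧
        MapsTo H (ball a r) (ball (H a) ρ) := fun a w => by
    by_cases h : a ∈ A ∧ N ≤ w.length
    · obtain ⟨v, H, hvH⟩ := hAg.exists_inverse_branch_symmetry hAf hρ hballG hballF hsymG hsymF hM
        h.1 (hsF ▸ hN w h.2 a h.1)
      rw [← hsF, ← hr] at hvH
      exact ⟨v, H, fun _ _ => hvH⟩
    · exact ⟨[], id, fun h1 h2 => absurd ⟨h1, h2⟩ h⟩
  choose v H hvH using key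
  obtain ⟨η, hη, hrig⟩ := hAg.exists_eqOn_of_norm_sub_le hA2 hρ hballG hsymG hr0 hs
    (add_pos hR hρ)
  obtain ⟨K, hK⟩ := exists_ncard_domRestrict_le hr0 (add_pos hR hρ) hη
  refine ⟨v, H, K, fun C => ?_, fun a ha w hw => ?_, fun a ha => hK a _ ?_ ?_ ?_⟩
  · obtain ⟨n₀, hn₀⟩ := hAg.tendsto_norm_deriv_word (show 0 < min sF 1 ^ (C + 1) by positivity)
    refine ⟨n₀, fun a ha w hw hwn => ?_⟩
    by_contra! hlt
    have hmin : 0 ≤ min sF 1 := by positivity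
    refine (hn₀ w hwn a ha).not_ge (le_trans ?_ (hvH a w ha hw).2.1)
    exact (pow_le_pow_of_le_one hmin (min_le_right _ _) (by lia)).trans
      (pow_le_pow_left₀ hmin (min_le_left _ _) _)
  · obtain ⟨hv, -, hsymm, hFH, hmaps⟩ := hvH a w ha hw
    refine ⟨hv, hsymm.differentiableOn, hsymm.injOn, hFH, ?_, hmaps.image_subset,
      hsymm.differentiableOn, hsymm.mem_iff⟩
    refine (ball_subset_ball ?_).trans
      (ball_subset_image_of_injOn hr0 hsymm.differentiableOn hsymm.injOn)
    have h1 : 4 / 25 * ρ ≤ r := hr ▸ mul_le_mul_of_nonneg_right koebeRadius_gt.le hρ.le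
    have := mul_le_mul hsymm.le_norm_deriv h1 (by positivity) (norm_nonneg _)
    linarith
  · rintro _ ⟨w, hw, rfl⟩
    exact (hvH a w ha hw).2.2.1.differentiableOn
  · rintro _ ⟨w, hw, rfl⟩
    exact (hvH a w ha hw).2.2.1.norm_le
  · rintro _ ⟨w₁, hw₁, rfl⟩ _ ⟨w₂, hw₂, rfl⟩
    exact hrig a ha _ _ (hvH a w₁ ha hw₁).2.2.1 (hvH a w₂ ha hw₂).2.2.1
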